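/- Strong Morita equivalence of twisted coactions of a finite dimensional C*-Hopf algebra's dual H^0 on unital C*-algebras is an equivalence relation; in particular, if (ρ,u), (σ,v), (γ,w) are twisted coactions of H^0 on A, B, C with (ρ,u) strongly Morita equivalent to (σ,v) via (X,λ) and (σ,v) strongly Morita equivalent to (γ,w) via (Y,μ), then h·_{λ⊗μ}(x⊗y) = [h_(1)·_λ x]⊗[h_(2)·_μ y] defines a twisted coaction on X⊗_B Y implementing a strong Morita equivalence between (ρ,u) and (γ,w). -/

import Mathlib

open scoped TensorProduct
open Filter Topology
set_option maxHeartbeats 1000000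
set_option linter.unusedSectionVars false
set_option synthInstance.maxHeartbeats 400000
noncomputable section
namespace SMEPaper
universe u

/-! ### Generalities on tensor products with a finite dimensional C*-algebra -/

/-- Contraction of the right tensor factor against a linear functional:
`appRight f (m ⊗ c) = f c • m`. -/
def appRight {M C : Type*} [AddCommGroup M] [Module ℂ M] [AddCommGroup C] [Module ℂ C]
    (f : C →ₗ[ℂ] ℂ) : M ⊗[ℂ] C →ₗ[ℂ] M :=
  (TensorProduct.rid ℂ M).toLinearMap ∘ₗ TensorProduct.map LinearMap.id f

/-- The `i`-th coordinate, with respect to the canonical finite basis of `C`, of an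
element of `M ⊗[ℂ] C`. -/
def tcoord {M C : Type*} [AddCommGroup M] [Module ℂ M] [AddCommGroup C] [Module ℂ C]
    [FiniteDimensional ℂ C] (i : Fin (Module.finrank ℂ C)) : M ⊗[ℂ] C →ₗ[ℂ] M :=
  appRight ((Module.finBasis ℂ C).coord i)

/-- The star operation on `M ⊗[ℂ] C` (`C` finite dimensional) where the star operation on the
first factor is supplied as a function: on simple tensors, `m ⊗ c ↦ sM m ⊗ star c`. -/
def tstarWith {M C : Type*} [AddCommGroup M] [Module ℂ M] [Ring C] [Algebra ℂ C]
    [StarRing C] [FiniteDimensional ℂ C] (sM : M → M) (t : M ⊗[ℂ] C) : M ⊗[ℂ] C :=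
  ∑ i, sM (tcoord i t) ⊗ₜ star (Module.finBasis ℂ C i)

/-- Combination of an operation on the first factors and an operation on the second (finite
dimensional) factors to an operation on tensor products: on simple tensors,
`tmix op cop (p ⊗ c) (q ⊗ d) = op p q ⊗ cop c d`. -/
def tmix {P Q R C : Type*} [AddCommGroup P] [Module ℂ P] [AddCommGroup Q] [Module ℂ Q]
    [AddCommGroup R] [Module ℂ R] [Ring C] [Algebra ℂ C] [FiniteDimensional ℂ C]
    (op : P → Q → R) (cop : C → C → C) (s : P ⊗[ℂ] C) (t : Q ⊗[ℂ] C) : R ⊗[ℂ] C :=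
  ∑ i, ∑ j,
    op (tcoord i s) (tcoord j t) ⊗ₜ cop (Module.finBasis ℂ C i) (Module.finBasis ℂ C j)

/-- The operation on tensor products induced by an operation on the first factors (and
multiplication in the second): `tact op (p ⊗ c) (q ⊗ d) = op p q ⊗ (c * d)`. -/
def tact {P Q R C : Type*} [AddCommGroup P] [Module ℂ P] [AddCommGroup Q] [Module ℂ Q]
    [AddCommGroup R] [Module ℂ R] [Ring C] [Algebra ℂ C] [FiniteDimensional ℂ C]
    (op : P → Q → R) : P ⊗[ℂ] C → Q ⊗[ℂ] C → R ⊗[ℂ] C :=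
  tmix op (· * ·)

/-- The left inner product on `X ⊗ C` induced by a left (`A`-valued) inner product on `X`:
`(x ⊗ c), (y ⊗ d) ↦ inn x y ⊗ (c * star d)`. -/
def tinnL {X A C : Type*} [AddCommGroup X] [Module ℂ X] [AddCommGroup A] [Module ℂ A]
    [Ring C] [Algebra ℂ C] [StarRing C] [FiniteDimensional ℂ C]
    (inn : X → X → A) : X ⊗[ℂ] C → X ⊗[ℂ] C → A ⊗[ℂ] C :=
  tmix inn (fun c d => c * star d)

/-- The right inner product on `X ⊗ C` induced by a right (`B`-valued) inner product on `X`: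
`(x ⊗ c), (y ⊗ d) ↦ inn x y ⊗ (star c * d)`. -/
def tinnR {X B C : Type*} [AddCommGroup X] [Module ℂ X] [AddCommGroup B] [Module ℂ B]
    [Ring C] [Algebra ℂ C] [StarRing C] [FiniteDimensional ℂ C]
    (inn : X → X → B) : X ⊗[ℂ] C → X ⊗[ℂ] C → B ⊗[ℂ] C :=
  tmix inn (fun c d => star c * d)

/-! ### Finite dimensional C*-Hopf algebras -/

/-- The data and axioms of a finite dimensional C*-Hopf algebra structure on the finite
dimensional C*-algebra `H0`: a comultiplication, counit and antipode satisfying the Hopf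
algebra axioms, compatibly with the ⋆-structure. -/
structure HopfAlgData (H0 : Type u) [Ring H0] [Algebra ℂ H0] [StarRing H0]
    [StarModule ℂ H0] [FiniteDimensional ℂ H0] where
  comul : H0 →ₐ[ℂ] H0 ⊗[ℂ] H0
  counit : H0 →ₐ[ℂ] ℂ
  antipode : H0 →ₗ[ℂ] H0
  coassoc : ∀ h, TensorProduct.map comul.toLinearMap LinearMap.id (comul h)
      = (TensorProduct.assoc ℂ H0 H0 H0).symm
          (TensorProduct.map LinearMap.id comul.toLinearMap (comul h))
  counit_left : ∀ h,
      (TensorProduct.lid ℂ H0) (TensorProduct.map counit.toLinearMap LinearMap.id (comul h)) = h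
  counit_right : ∀ h, appRight counit.toLinearMap (comul h) = h
  antipode_left : ∀ (h : H0) (n : ℕ) (h1 h2 : Fin n → H0),
      comul h = ∑ i, h1 i ⊗ₜ h2 i → ∑ i, antipode (h1 i) * h2 i = counit h • 1
  antipode_right : ∀ (h : H0) (n : ℕ) (h1 h2 : Fin n → H0),
      comul h = ∑ i, h1 i ⊗ₜ h2 i → ∑ i, h1 i * antipode (h2 i) = counit h • 1
  comul_star : ∀ h, comul (star h) = tstarWith star (comul h)
  counit_star : ∀ h, counit (star h) = starRingEnd ℂ (counit h)

/-! ### Coactions on C*-algebras -/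

section Coaction
variable {H0 : Type u} [Ring H0] [Algebra ℂ H0] [StarRing H0] [StarModule ℂ H0]
  [FiniteDimensional ℂ H0]
variable {A B X : Type u} [Ring A] [Algebra ℂ A] [StarRing A]
  [Ring B] [Algebra ℂ B] [StarRing B] [AddCommGroup X] [Module ℂ X]

/-- `ρ : A → A ⊗ H0` is a weak coaction of `H0` (with counit `ε0`) on `A`:
a unital ⋆-homomorphism with `(id ⊗ ε0) ∘ ρ = id`. -/
structure IsWeakCoaction (ε0 : H0 →ₗ[ℂ] ℂ) (ρ : A →ₗ[ℂ] A ⊗[ℂ] H0) : Prop where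
  map_one : ρ 1 = 1
  map_mul : ∀ a b, ρ (a * b) = ρ a * ρ b
  map_star : ∀ a, ρ (star a) = tstarWith star (ρ a)
  counital : ∀ a, appRight ε0 (ρ a) = a

/-- `ρ : A → A ⊗ H0` is a coaction of `H0` (with comultiplication `Δ0`, counit `ε0`) on `A`:
a weak coaction with `(ρ ⊗ id) ∘ ρ = (id ⊗ Δ0) ∘ ρ`. -/
structure IsCoaction (Δ0 : H0 →ₗ[ℂ] H0 ⊗[ℂ] H0) (ε0 : H0 →ₗ[ℂ] ℂ)
    (ρ : A →ₗ[ℂ] A ⊗[ℂ] H0) extends IsWeakCoaction ε0 ρ : Prop where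
  coassoc : ∀ a, TensorProduct.map ρ LinearMap.id (ρ a)
      = (TensorProduct.assoc ℂ A H0 H0).symm (TensorProduct.map LinearMap.id Δ0 (ρ a))

/-- The pair `(ρ, u)` is a twisted coaction of `H0` on `A`. -/
structure IsTwistedCoaction (Δ0 : H0 →ₗ[ℂ] H0 ⊗[ℂ] H0) (ε0 : H0 →ₗ[ℂ] ℂ)
    (ρ : A →ₗ[ℂ] A ⊗[ℂ] H0) (u : (A ⊗[ℂ] H0) ⊗[ℂ] H0)
    extends IsWeakCoaction ε0 ρ : Prop where
  unitary_left : u * tstarWith (tstarWith star) u = 1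
  unitary_right : tstarWith (tstarWith star) u * u = 1
  twisted_coassoc : ∀ a, TensorProduct.map ρ LinearMap.id (ρ a)
      = u * ((TensorProduct.assoc ℂ A H0 H0).symm (TensorProduct.map LinearMap.id Δ0 (ρ a)))
        * tstarWith (tstarWith star) u
  cocycle : (u ⊗ₜ (1 : H0))
        * TensorProduct.map ((TensorProduct.assoc ℂ A H0 H0).symm.toLinearMap
            ∘ₗ TensorProduct.map LinearMap.id Δ0) LinearMap.id u
      = TensorProduct.map (TensorProduct.map ρ LinearMap.id) LinearMap.id u
        * (TensorProduct.assoc ℂ (A ⊗[ℂ] H0) H0 H0).symm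
            (TensorProduct.map LinearMap.id Δ0 u)
  counit_mid : ∀ h : Module.Dual ℂ H0, appRight h (appRight ε0 u) = h 1 • (1 : A)
  counit_out : ∀ h : Module.Dual ℂ H0, appRight ε0 (appRight h u) = h 1 • (1 : A)

/-- The trivial coaction `a ↦ a ⊗ 1` of `H0` on `A`. -/
def trivialCoaction (H0 : Type u) [Ring H0] [Algebra ℂ H0] (A : Type u) [Ring A]
    [Algebra ℂ A] : A →ₗ[ℂ] A ⊗[ℂ] H0 :=
  (TensorProduct.mk ℂ A H0).flip 1

end Coaction

/-! ### Hilbert bimodules -/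

/-- A (pre-)Hilbert `A`–`B` bimodule structure on `X`: a bimodule with a left `A`-valued and a
right `B`-valued inner product, compatible with the module actions, with the appropriate
(conjugate-)linearity, symmetry, positivity and definiteness properties. -/
structure Bimod (A B X : Type u) [Ring A] [Algebra ℂ A] [StarRing A]
    [Ring B] [Algebra ℂ B] [StarRing B] [AddCommGroup X] [Module ℂ X] where
  ls : A → X → X
  rs : X → B → X
  linn : X → X → A
  rinn : X → X → B
  ls_one : ∀ x, ls 1 x = x
  ls_mul : ∀ a a' x, ls (a * a') x = ls a (ls a' x)
  ls_add : ∀ a a' x, ls (a + a') x = ls a x + ls a' x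
  ls_add' : ∀ a x y, ls a (x + y) = ls a x + ls a y
  ls_smul : ∀ (c : ℂ) a x, ls (c • a) x = c • ls a x
  ls_smul' : ∀ (c : ℂ) a x, ls a (c • x) = c • ls a x
  rs_one : ∀ x, rs x 1 = x
  rs_mul : ∀ x b b', rs x (b * b') = rs (rs x b) b'
  rs_add : ∀ x b b', rs x (b + b') = rs x b + rs x b'
  rs_add' : ∀ x y b, rs (x + y) b = rs x b + rs y b
  rs_smul : ∀ (c : ℂ) x b, rs x (c • b) = c • rs x b
  rs_smul' : ∀ (c : ℂ) x b, rs (c • x) b = c • rs x b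
  ls_rs : ∀ a x b, ls a (rs x b) = rs (ls a x) b
  linn_add_left : ∀ x y z, linn (x + y) z = linn x z + linn y z
  linn_add_right : ∀ x y z, linn x (y + z) = linn x y + linn x z
  rinn_add_left : ∀ x y z, rinn (x + y) z = rinn x z + rinn y z
  rinn_add_right : ∀ x y z, rinn x (y + z) = rinn x y + rinn x z
  linn_smul_left : ∀ (c : ℂ) x y, linn (c • x) y = c • linn x y
  linn_smul_right : ∀ (c : ℂ) x y, linn x (c • y) = starRingEnd ℂ c • linn x y
  rinn_smul_left : ∀ (c : ℂ) x y, rinn (c • x) y = starRingEnd ℂ c • rinn x y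
  rinn_smul_right : ∀ (c : ℂ) x y, rinn x (c • y) = c • rinn x y
  linn_star : ∀ x y, star (linn x y) = linn y x
  rinn_star : ∀ x y, star (rinn x y) = rinn y x
  linn_ls : ∀ a x y, linn (ls a x) y = a * linn x y
  rinn_rs : ∀ x y b, rinn x (rs y b) = rinn x y * b
  linn_rs : ∀ x y b, linn (rs x b) y = linn x (rs y (star b))
  rinn_ls : ∀ a x y, rinn (ls a x) y = rinn x (ls (star a) y)
  linn_pos : ∀ x, ∃ a, linn x x = star a * a
  rinn_pos : ∀ x, ∃ b, rinn x x = star b * b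
  rinn_def : ∀ x, rinn x x = 0 → x = 0

section BimodDefs
variable {A B X : Type u} [Ring A] [Algebra ℂ A] [StarRing A]
    [Ring B] [Algebra ℂ B] [StarRing B] [AddCommGroup X] [Module ℂ X]

/-- A Hilbert bimodule is of finite type if it admits a finite right basis and a finite left
basis in the sense of Kajiwara–Watatani. -/
def Bimod.FiniteType (bm : Bimod A B X) : Prop :=
  (∃ (n : ℕ) (u : Fin n → X), ∀ x, ∑ i, bm.rs (u i) (bm.rinn (u i) x) = x) ∧
  (∃ (m : ℕ) (v : Fin m → X), ∀ x, ∑ j, bm.ls (bm.linn x (v j)) (v j) = x)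

/-- An equivalence bimodule: both inner products are full and the associativity condition
`_A⟨x,y⟩ • z = x • ⟨y,z⟩_B` holds. -/
def Bimod.IsEquivalence (bm : Bimod A B X) : Prop :=
  (∀ x y z, bm.ls (bm.linn x y) z = bm.rs x (bm.rinn y z)) ∧
  Submodule.span ℂ (Set.range fun p : X × X => bm.linn p.1 p.2) = ⊤ ∧
  Submodule.span ℂ (Set.range fun p : X × X => bm.rinn p.1 p.2) = ⊤

end BimodDefs

/-! ### Coactions on Hilbert bimodules, covariant systems, strong Morita equivalence -/

section BimodCoaction
variable {H0 : Type u} [Ring H0] [Algebra ℂ H0] [StarRing H0] [StarModule ℂ H0]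
  [FiniteDimensional ℂ H0]
variable {A B X : Type u} [Ring A] [Algebra ℂ A] [StarRing A]
  [Ring B] [Algebra ℂ B] [StarRing B] [AddCommGroup X] [Module ℂ X]

/-- `(A, B, X, ρ, σ, λ, H0)` is a weak covariant system: `lam` is a weak coaction of `H0` on
the Hilbert `A`–`B` bimodule `X` with respect to `(A, B, ρ, σ)`. -/
structure IsWeakCoactionBimod (ε0 : H0 →ₗ[ℂ] ℂ) (bm : Bimod A B X)
    (ρ : A →ₗ[ℂ] A ⊗[ℂ] H0) (σ : B →ₗ[ℂ] B ⊗[ℂ] H0)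
    (lam : X →ₗ[ℂ] X ⊗[ℂ] H0) : Prop where
  ls_compat : ∀ a x, lam (bm.ls a x) = tact bm.ls (ρ a) (lam x)
  rs_compat : ∀ x b, lam (bm.rs x b) = tact bm.rs (lam x) (σ b)
  linn_compat : ∀ x y, ρ (bm.linn x y) = tinnL bm.linn (lam x) (lam y)
  rinn_compat : ∀ x y, σ (bm.rinn x y) = tinnR bm.rinn (lam x) (lam y)
  counital : ∀ x, appRight ε0 (lam x) = x

/-- `(A, B, X, ρ, σ, λ, H0)` is a covariant system: `lam` is a coaction of `H0` on the
Hilbert `A`–`B` bimodule `X` with respect to `(A, B, ρ, σ)`. -/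
structure IsCoactionBimod (Δ0 : H0 →ₗ[ℂ] H0 ⊗[ℂ] H0) (ε0 : H0 →ₗ[ℂ] ℂ) (bm : Bimod A B X)
    (ρ : A →ₗ[ℂ] A ⊗[ℂ] H0) (σ : B →ₗ[ℂ] B ⊗[ℂ] H0) (lam : X →ₗ[ℂ] X ⊗[ℂ] H0)
    extends IsWeakCoactionBimod ε0 bm ρ σ lam : Prop where
  coassoc : ∀ x, TensorProduct.map lam LinearMap.id (lam x)
      = (TensorProduct.assoc ℂ X H0 H0).symm (TensorProduct.map LinearMap.id Δ0 (lam x))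

/-- `(A, B, X, ρ, u, σ, v, λ, H0)` is a twisted covariant system: `lam` is a twisted coaction
of `H0` on the Hilbert `A`–`B` bimodule `X` with respect to `(A, B, ρ, u, σ, v)`. -/
structure IsTwistedCoactionBimod (Δ0 : H0 →ₗ[ℂ] H0 ⊗[ℂ] H0) (ε0 : H0 →ₗ[ℂ] ℂ)
    (bm : Bimod A B X) (ρ : A →ₗ[ℂ] A ⊗[ℂ] H0) (u : (A ⊗[ℂ] H0) ⊗[ℂ] H0)
    (σ : B →ₗ[ℂ] B ⊗[ℂ] H0) (v : (B ⊗[ℂ] H0) ⊗[ℂ] H0) (lam : X →ₗ[ℂ] X ⊗[ℂ] H0)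
    extends IsWeakCoactionBimod ε0 bm ρ σ lam : Prop where
  twisted : ∀ x, TensorProduct.map lam LinearMap.id (lam x)
      = tact (tact bm.rs)
          (tact (tact bm.ls) u
            ((TensorProduct.assoc ℂ X H0 H0).symm (TensorProduct.map LinearMap.id Δ0 (lam x))))
          (tstarWith (tstarWith star) v)

/-- Two weak coactions `ρ` (on `A`) and `σ` (on `B`) of `H0` are strongly Morita equivalent
if there are an `A`–`B` equivalence bimodule `X` and a weak coaction of `H0` on `X` with
respect to `(A, B, ρ, σ)`. -/
def WeakSME (ε0 : H0 →ₗ[ℂ] ℂ) (ρ : A →ₗ[ℂ] A ⊗[ℂ] H0) (σ : B →ₗ[ℂ] B ⊗[ℂ] H0) : Prop :=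
  ∃ (X : Type u) (_ : AddCommGroup X) (_ : Module ℂ X) (bm : Bimod A B X),
    bm.IsEquivalence ∧ ∃ lam : X →ₗ[ℂ] X ⊗[ℂ] H0, IsWeakCoactionBimod ε0 bm ρ σ lam

/-- Two coactions `ρ` (on `A`) and `σ` (on `B`) of `H0` are strongly Morita equivalent if
there are an `A`–`B` equivalence bimodule `X` and a coaction of `H0` on `X` with respect to
`(A, B, ρ, σ)`. -/
def CoactSME (Δ0 : H0 →ₗ[ℂ] H0 ⊗[ℂ] H0) (ε0 : H0 →ₗ[ℂ] ℂ)
    (ρ : A →ₗ[ℂ] A ⊗[ℂ] H0) (σ : B →ₗ[ℂ] B ⊗[ℂ] H0) : Prop :=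
  ∃ (X : Type u) (_ : AddCommGroup X) (_ : Module ℂ X) (bm : Bimod A B X),
    bm.IsEquivalence ∧ ∃ lam : X →ₗ[ℂ] X ⊗[ℂ] H0, IsCoactionBimod Δ0 ε0 bm ρ σ lam

/-- Two twisted coactions `(ρ, u)` (on `A`) and `(σ, v)` (on `B`) of `H0` are strongly Morita
equivalent if there are an `A`–`B` equivalence bimodule `X` and a twisted coaction of `H0` on
`X` with respect to `(A, B, ρ, u, σ, v)`. -/
def TwistedSME (Δ0 : H0 →ₗ[ℂ] H0 ⊗[ℂ] H0) (ε0 : H0 →ₗ[ℂ] ℂ)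
    (ρ : A →ₗ[ℂ] A ⊗[ℂ] H0) (u : (A ⊗[ℂ] H0) ⊗[ℂ] H0)
    (σ : B →ₗ[ℂ] B ⊗[ℂ] H0) (v : (B ⊗[ℂ] H0) ⊗[ℂ] H0) : Prop :=
  ∃ (X : Type u) (_ : AddCommGroup X) (_ : Module ℂ X) (bm : Bimod A B X),
    bm.IsEquivalence ∧
      ∃ lam : X →ₗ[ℂ] X ⊗[ℂ] H0, IsTwistedCoactionBimod Δ0 ε0 bm ρ u σ v lam

end BimodCoaction
/-! ### A finite dimensional C*-Hopf algebra together with its dual -/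

/-- A finite dimensional C*-Hopf algebra `H` together with its dual C*-Hopf algebra `H0`:
Hopf algebra structures on both, a perfect pairing compatible with all the structure, and
the distinguished (Haar) projections `e ∈ H` and `τ ∈ H0`. -/
structure HopfPairData (H H0 : Type u) [Ring H] [Algebra ℂ H] [StarRing H] [StarModule ℂ H]
    [FiniteDimensional ℂ H] [Ring H0] [Algebra ℂ H0] [StarRing H0] [StarModule ℂ H0]
    [FiniteDimensional ℂ H0] where
  dH : HopfAlgData H
  dH0 : HopfAlgData H0
  pair : H →ₗ[ℂ] H0 →ₗ[ℂ] ℂ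
  perfect : Function.Bijective fun h => pair h
  perfect' : Function.Bijective fun φ => pair.flip φ
  pair_mul_left : ∀ (h l : H) (φ : H0) (n : ℕ) (φ1 φ2 : Fin n → H0),
      dH0.comul φ = ∑ i, φ1 i ⊗ₜ φ2 i →
      pair (h * l) φ = ∑ i, pair h (φ1 i) * pair l (φ2 i)
  pair_mul_right : ∀ (h : H) (φ ψ : H0) (n : ℕ) (h1 h2 : Fin n → H),
      dH.comul h = ∑ i, h1 i ⊗ₜ h2 i →
      pair h (φ * ψ) = ∑ i, pair (h1 i) φ * pair (h2 i) ψ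
  pair_one_left : ∀ φ, pair 1 φ = dH0.counit φ
  pair_one_right : ∀ h, pair h 1 = dH.counit h
  pair_antipode : ∀ h φ, pair (dH.antipode h) φ = pair h (dH0.antipode φ)
  pair_star : ∀ h φ, pair (star h) φ = starRingEnd ℂ (pair h (star (dH0.antipode φ)))
  pair_star' : ∀ h φ, pair h (star φ) = starRingEnd ℂ (pair (star (dH.antipode h)) φ)
  haar : H
  haar_star : star haar = haar
  haar_idem : haar * haar = haar
  haar_absorb : ∀ h, h * haar = dH.counit h • haar
  haar_absorb' : ∀ h, haar * h = dH.counit h • haar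
  counit_haar : dH.counit haar = 1
  haar0 : H0
  haar0_star : star haar0 = haar0
  haar0_idem : haar0 * haar0 = haar0
  haar0_absorb : ∀ φ, φ * haar0 = dH0.counit φ • haar0
  haar0_absorb' : ∀ φ, haar0 * φ = dH0.counit φ • haar0
  counit_haar0 : dH0.counit haar0 = 1

section DualAct
variable {H H0 : Type u} [Ring H] [Algebra ℂ H] [StarRing H] [StarModule ℂ H]
    [FiniteDimensional ℂ H] [Ring H0] [Algebra ℂ H0] [StarRing H0] [StarModule ℂ H0]
    [FiniteDimensional ℂ H0]

/-- The action of `h ∈ H` on `M` induced by a coaction-type map `ρ : M → M ⊗ H0` of the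
dual `H0`:  `h ·_ρ m = (id ⊗ h)(ρ m)`. -/
def coactAct {M : Type u} [AddCommGroup M] [Module ℂ M] (dp : HopfPairData H H0)
    (ρ : M →ₗ[ℂ] M ⊗[ℂ] H0) (h : H) (m : M) : M :=
  appRight (dp.pair h) (ρ m)

end DualAct

/-- A unital C*-algebra equipped with a linear map `A → A ⊗ H0` and a 2-cocycle element
`u ∈ A ⊗ H0 ⊗ H0` (a candidate twisted coaction of `H0`). -/
structure TwCoactedCStar (H0 : Type u) [Ring H0] [Algebra ℂ H0] [StarRing H0]
    [StarModule ℂ H0] [FiniteDimensional ℂ H0] : Type (u + 1) where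
  carrier : Type u
  [cstar : CStarAlgebra carrier]
  [smod : StarModule ℂ carrier]
  coact : carrier →ₗ[ℂ] carrier ⊗[ℂ] H0
  cocyc : (carrier ⊗[ℂ] H0) ⊗[ℂ] H0

attribute [instance] TwCoactedCStar.cstar TwCoactedCStar.smod

/-! ### Bundled semilinear forms of the operations on tensor products -/

section Tensor

theorem appRight_tmul {M C : Type*} [AddCommGroup M] [Module ℂ M] [AddCommGroup C] [Module ℂ C]
    (f : C →ₗ[ℂ] ℂ) (m : M) (c : C) : appRight f (m ⊗ₜ[ℂ] c) = f c • m := by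
  simp [appRight]

theorem sum_tcoord_tmul {M C : Type*} [AddCommGroup M] [Module ℂ M] [AddCommGroup C] [Module ℂ C]
    [FiniteDimensional ℂ C] (t : M ⊗[ℂ] C) :
    ∑ i, tcoord i t ⊗ₜ[ℂ] Module.finBasis ℂ C i = t := by
  induction t using TensorProduct.induction_on with
  | zero => simp
  | add x y hx hy =>
    simp only [map_add, TensorProduct.add_tmul, Finset.sum_add_distrib, hx, hy]
  | tmul m c =>
    simp only [tcoord, appRight_tmul, TensorProduct.smul_tmul]
    rw [← TensorProduct.tmul_sum]
    congr 1
    exact (Module.finBasis ℂ C).sum_repr c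

theorem tmix_eq_map₂ {σ τ : ℂ →+* ℂ} {P Q R C : Type*} [AddCommGroup P] [Module ℂ P]
    [AddCommGroup Q] [Module ℂ Q] [AddCommGroup R] [Module ℂ R] [Ring C] [Algebra ℂ C]
    [FiniteDimensional ℂ C] (f : P →ₛₗ[σ] Q →ₛₗ[τ] R) (g : C →ₛₗ[σ] C →ₛₗ[τ] C)
    (s : P ⊗[ℂ] C) (t : Q ⊗[ℂ] C) :
    tmix (fun p q => f p q) (fun c d => g c d) s t = TensorProduct.map₂ f g s t := by
  conv_rhs => rw [← sum_tcoord_tmul s, ← sum_tcoord_tmul t]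
  simp only [tmix, map_sum, LinearMap.sum_apply, TensorProduct.map₂_apply_tmul]
  rw [Finset.sum_comm]
  simp only [TensorProduct.map_tmul]

theorem tstarWith_eq_map {M C : Type*} [AddCommGroup M] [Module ℂ M] [Ring C] [Algebra ℂ C]
    [StarRing C] [StarModule ℂ C] [FiniteDimensional ℂ C] (f : M →ₛₗ[starRingEnd ℂ] M)
    (t : M ⊗[ℂ] C) :
    tstarWith (fun m => f m) t
      = TensorProduct.map f (starLinearEquiv ℂ (A := C)).toLinearMap t := by
  conv_rhs => rw [← sum_tcoord_tmul t]
  simp [tstarWith]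

end Tensor

section Forms
variable {C : Type*} [Ring C] [Algebra ℂ C]
variable {P Q R S U V : Type*} [AddCommGroup P] [Module ℂ P] [AddCommGroup Q] [Module ℂ Q]
  [AddCommGroup R] [Module ℂ R] [AddCommGroup S] [Module ℂ S] [AddCommGroup U] [Module ℂ U]
  [AddCommGroup V] [Module ℂ V]

variable (C) in
/-- The bilinear map `(p ⊗ c, q ⊗ d) ↦ f p q ⊗ (c * d)`. -/
def tensorAct (f : P →ₗ[ℂ] Q →ₗ[ℂ] R) : (P ⊗[ℂ] C) →ₗ[ℂ] (Q ⊗[ℂ] C) →ₗ[ℂ] (R ⊗[ℂ] C) :=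
  TensorProduct.map₂ f (LinearMap.mul ℂ C)

@[simp]
theorem tensorAct_tmul (f : P →ₗ[ℂ] Q →ₗ[ℂ] R) (p : P) (q : Q) (c d : C) :
    tensorAct C f (p ⊗ₜ c) (q ⊗ₜ d) = f p q ⊗ₜ (c * d) := by
  simp [tensorAct]

theorem tact_eq_tensorAct [FiniteDimensional ℂ C] (f : P →ₗ[ℂ] Q →ₗ[ℂ] R) :
    tact (C := C) (fun p q => f p q) = fun s t => tensorAct C f s t := by
  funext s t
  exact tmix_eq_map₂ f (LinearMap.mul ℂ C) s t

theorem tensorAct_assoc {f₁ : R →ₗ[ℂ] S →ₗ[ℂ] U} {f₂ : P →ₗ[ℂ] Q →ₗ[ℂ] R}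
    {f₃ : P →ₗ[ℂ] V →ₗ[ℂ] U} {f₄ : Q →ₗ[ℂ] S →ₗ[ℂ] V}
    (h : ∀ p q s, f₁ (f₂ p q) s = f₃ p (f₄ q s)) (p : P ⊗[ℂ] C) (q : Q ⊗[ℂ] C) (s : S ⊗[ℂ] C) :
    tensorAct C f₁ (tensorAct C f₂ p q) s = tensorAct C f₃ p (tensorAct C f₄ q s) := by
  induction p using TensorProduct.induction_on with
  | zero => simp
  | add x y hx hy => simp only [map_add, LinearMap.add_apply, hx, hy]
  | tmul p c =>
  induction q using TensorProduct.induction_on with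
  | zero => simp
  | add x y hx hy => simp only [map_add, LinearMap.add_apply, hx, hy]
  | tmul q d =>
  induction s using TensorProduct.induction_on with
  | zero => simp
  | add x y hx hy => simp only [map_add, hx, hy]
  | tmul s e => simp [h, mul_assoc]

theorem tensorAct_mul {A : Type*} [Ring A] [Algebra ℂ A] (s t : A ⊗[ℂ] C) :
    tensorAct C (LinearMap.mul ℂ A) s t = s * t := by
  induction s using TensorProduct.induction_on with
  | zero => simp
  | add x y hx hy => simp only [map_add, LinearMap.add_apply, hx, hy, add_mul]
  | tmul p c =>
  induction t using TensorProduct.induction_on with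
  | zero => simp
  | add x y hx hy => simp only [map_add, hx, hy, mul_add]
  | tmul q d => simp

theorem tensorAct_mul_eq {A : Type*} [Ring A] [Algebra ℂ A] :
    tensorAct C (LinearMap.mul ℂ A) = LinearMap.mul ℂ (A ⊗[ℂ] C) := by
  refine LinearMap.ext fun s => LinearMap.ext fun t => ?_
  exact tensorAct_mul s t

theorem tensorAct_one_left {A : Type*} [Ring A] [Algebra ℂ A] {f : A →ₗ[ℂ] P →ₗ[ℂ] P}
    (h : ∀ p, f 1 p = p) (s : P ⊗[ℂ] C) : tensorAct C f 1 s = s := by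
  induction s using TensorProduct.induction_on with
  | zero => simp
  | add x y hx hy => simp only [map_add, hx, hy]
  | tmul p c => simp [Algebra.TensorProduct.one_def, h]

theorem appRight_tensorAct (ε : C →ₗ[ℂ] ℂ) (hε : ∀ c d, ε (c * d) = ε c * ε d)
    (f : P →ₗ[ℂ] Q →ₗ[ℂ] R) (s : P ⊗[ℂ] C) (t : Q ⊗[ℂ] C) :
    appRight ε (tensorAct C f s t) = f (appRight ε s) (appRight ε t) := by
  induction s using TensorProduct.induction_on with
  | zero => simp
  | add x y hx hy => simp only [map_add, LinearMap.add_apply, hx, hy]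
  | tmul p c =>
  induction t using TensorProduct.induction_on with
  | zero => simp
  | add x y hx hy => simp only [map_add, hx, hy]
  | tmul q d => simp [appRight_tmul, hε, mul_smul, smul_comm (ε c)]

/-- The map `id ⊗ Δ : P ⊗ C → (P ⊗ C) ⊗ C`. -/
def expand (Δ : C →ₗ[ℂ] C ⊗[ℂ] C) : P ⊗[ℂ] C →ₗ[ℂ] (P ⊗[ℂ] C) ⊗[ℂ] C :=
  (TensorProduct.assoc ℂ P C C).symm.toLinearMap ∘ₗ TensorProduct.map LinearMap.id Δ

theorem expand_tensorAct (Δ : C →ₐ[ℂ] C ⊗[ℂ] C) (f : P →ₗ[ℂ] Q →ₗ[ℂ] R)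
    (s : P ⊗[ℂ] C) (t : Q ⊗[ℂ] C) :
    expand Δ.toLinearMap (tensorAct C f s t)
      = tensorAct C (tensorAct C f) (expand Δ.toLinearMap s) (expand Δ.toLinearMap t) := by
  induction s using TensorProduct.induction_on with
  | zero => simp
  | add x y hx hy => simp only [map_add, LinearMap.add_apply, hx, hy]
  | tmul p c =>
  induction t using TensorProduct.induction_on with
  | zero => simp
  | add x y hx hy => simp only [map_add, hx, hy]
  | tmul q d =>
  simp only [expand, tensorAct_tmul, LinearMap.comp_apply, TensorProduct.map_tmul,
    LinearMap.id_apply, AlgHom.toLinearMap_apply, map_mul, LinearEquiv.coe_coe]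
  generalize Δ c = s
  generalize Δ d = t
  induction s using TensorProduct.induction_on with
  | zero => simp
  | add x y hx hy =>
    simp only [map_add, LinearMap.add_apply, hx, hy, add_mul, TensorProduct.tmul_add]
  | tmul c₁ c₂ =>
  induction t using TensorProduct.induction_on with
  | zero => simp
  | add x y hx hy => simp only [map_add, hx, hy, mul_add, TensorProduct.tmul_add]
  | tmul d₁ d₂ => simp

section Star
variable [StarRing C] [StarModule ℂ C]

variable (C) in
/-- The semilinear map `m ⊗ c ↦ f m ⊗ star c`. -/
def tensorStar (f : P →ₛₗ[starRingEnd ℂ] Q) : P ⊗[ℂ] C →ₛₗ[starRingEnd ℂ] Q ⊗[ℂ] C :=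
  TensorProduct.map f (starLinearEquiv ℂ (A := C)).toLinearMap

@[simp]
theorem tensorStar_tmul (f : P →ₛₗ[starRingEnd ℂ] Q) (p : P) (c : C) :
    tensorStar C f (p ⊗ₜ c) = f p ⊗ₜ star c := by
  simp [tensorStar]

theorem tstarWith_eq_tensorStar [FiniteDimensional ℂ C] (f : P →ₛₗ[starRingEnd ℂ] P) :
    tstarWith (C := C) (fun m => f m) = fun t => tensorStar C f t := by
  funext t
  exact tstarWith_eq_map f t

theorem tensorStar_involutive {f : P →ₛₗ[starRingEnd ℂ] Q} {g : Q →ₛₗ[starRingEnd ℂ] P}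
    (h : ∀ p, g (f p) = p) (t : P ⊗[ℂ] C) : tensorStar C g (tensorStar C f t) = t := by
  induction t using TensorProduct.induction_on with
  | zero => simp
  | add x y hx hy => simp only [map_add, hx, hy]
  | tmul p c => simp [h]

theorem tensorStar_tensorAct {f : P →ₗ[ℂ] Q →ₗ[ℂ] R} {j : R →ₛₗ[starRingEnd ℂ] U}
    {k : P →ₛₗ[starRingEnd ℂ] V} {l : Q →ₛₗ[starRingEnd ℂ] S} {g : S →ₗ[ℂ] V →ₗ[ℂ] U}
    (h : ∀ p q, j (f p q) = g (l q) (k p)) (s : P ⊗[ℂ] C) (t : Q ⊗[ℂ] C) :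
    tensorStar C j (tensorAct C f s t) = tensorAct C g (tensorStar C l t) (tensorStar C k s) := by
  induction s using TensorProduct.induction_on with
  | zero => simp
  | add x y hx hy => simp only [map_add, LinearMap.add_apply, hx, hy]
  | tmul p c =>
  induction t using TensorProduct.induction_on with
  | zero => simp
  | add x y hx hy => simp only [map_add, LinearMap.add_apply, hx, hy]
  | tmul q d => simp [h]

theorem expand_tensorStar (Δ : C →ₗ[ℂ] C ⊗[ℂ] C)
    (hΔ : ∀ c, Δ (star c) = tensorStar C (starLinearEquiv ℂ (A := C)).toLinearMap (Δ c))
    (f : P →ₛₗ[starRingEnd ℂ] Q) (t : P ⊗[ℂ] C) :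
    expand Δ (tensorStar C f t) = tensorStar C (tensorStar C f) (expand Δ t) := by
  induction t using TensorProduct.induction_on with
  | zero => simp
  | add x y hx hy => simp only [map_add, hx, hy]
  | tmul p c =>
  simp only [expand, tensorStar_tmul, LinearMap.comp_apply, TensorProduct.map_tmul,
    LinearMap.id_apply, LinearEquiv.coe_coe, hΔ]
  generalize Δ c = s
  induction s using TensorProduct.induction_on with
  | zero => simp
  | add x y hx hy => simp only [map_add, hx, hy, TensorProduct.tmul_add]
  | tmul c₁ c₂ => simp

variable (C) in
/-- The form `(p ⊗ c, q ⊗ d) ↦ f p q ⊗ (c * star d)`. -/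
def tensorInnL (f : P →ₗ[ℂ] Q →ₛₗ[starRingEnd ℂ] R) :
    (P ⊗[ℂ] C) →ₗ[ℂ] (Q ⊗[ℂ] C) →ₛₗ[starRingEnd ℂ] (R ⊗[ℂ] C) :=
  TensorProduct.map₂ f ((LinearMap.mul ℂ C).compl₂ (starLinearEquiv ℂ (A := C)).toLinearMap)

variable (C) in
/-- The form `(p ⊗ c, q ⊗ d) ↦ f p q ⊗ (star c * d)`. -/
def tensorInnR (f : P →ₛₗ[starRingEnd ℂ] Q →ₗ[ℂ] R) :
    (P ⊗[ℂ] C) →ₛₗ[starRingEnd ℂ] (Q ⊗[ℂ] C) →ₗ[ℂ] (R ⊗[ℂ] C) :=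
  TensorProduct.map₂ f ((LinearMap.mul ℂ C).comp (starLinearEquiv ℂ (A := C)).toLinearMap)

@[simp]
theorem tensorInnL_tmul (f : P →ₗ[ℂ] Q →ₛₗ[starRingEnd ℂ] R) (p : P) (q : Q) (c d : C) :
    tensorInnL C f (p ⊗ₜ c) (q ⊗ₜ d) = f p q ⊗ₜ (c * star d) := by
  simp [tensorInnL]

@[simp]
theorem tensorInnR_tmul (f : P →ₛₗ[starRingEnd ℂ] Q →ₗ[ℂ] R) (p : P) (q : Q) (c d : C) :
    tensorInnR C f (p ⊗ₜ c) (q ⊗ₜ d) = f p q ⊗ₜ (star c * d) := by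
  simp [tensorInnR]

theorem tinnL_eq_tensorInnL [FiniteDimensional ℂ C] (f : P →ₗ[ℂ] Q →ₛₗ[starRingEnd ℂ] R)
    (s : P ⊗[ℂ] C) (t : Q ⊗[ℂ] C) :
    tmix (fun p q => f p q) (fun c d => c * star d) s t = tensorInnL C f s t :=
  tmix_eq_map₂ f ((LinearMap.mul ℂ C).compl₂ (starLinearEquiv ℂ (A := C)).toLinearMap) s t

theorem tinnR_eq_tensorInnR [FiniteDimensional ℂ C] (f : P →ₛₗ[starRingEnd ℂ] Q →ₗ[ℂ] R)
    (s : P ⊗[ℂ] C) (t : Q ⊗[ℂ] C) :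
    tmix (fun p q => f p q) (fun c d => star c * d) s t = tensorInnR C f s t :=
  tmix_eq_map₂ f ((LinearMap.mul ℂ C).comp (starLinearEquiv ℂ (A := C)).toLinearMap) s t

theorem tensorInnL_eq_tensorAct_star {f : P →ₗ[ℂ] Q →ₛₗ[starRingEnd ℂ] R}
    {g : P →ₗ[ℂ] S →ₗ[ℂ] R} {j : Q →ₛₗ[starRingEnd ℂ] S} (h : ∀ p q, f p q = g p (j q))
    (s : P ⊗[ℂ] C) (t : Q ⊗[ℂ] C) :
    tensorInnL C f s t = tensorAct C g s (tensorStar C j t) := by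
  induction s using TensorProduct.induction_on with
  | zero => simp
  | add x y hx hy => simp only [map_add, LinearMap.add_apply, hx, hy]
  | tmul p c =>
  induction t using TensorProduct.induction_on with
  | zero => simp
  | add x y hx hy => simp only [map_add, hx, hy]
  | tmul q d => simp [h]

theorem tensorInnR_eq_tensorAct_star {f : P →ₛₗ[starRingEnd ℂ] Q →ₗ[ℂ] R}
    {g : S →ₗ[ℂ] Q →ₗ[ℂ] R} {j : P →ₛₗ[starRingEnd ℂ] S} (h : ∀ p q, f p q = g (j p) q)
    (s : P ⊗[ℂ] C) (t : Q ⊗[ℂ] C) :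
    tensorInnR C f s t = tensorAct C g (tensorStar C j s) t := by
  induction s using TensorProduct.induction_on with
  | zero => simp
  | add x y hx hy => simp only [map_add, LinearMap.add_apply, hx, hy]
  | tmul p c =>
  induction t using TensorProduct.induction_on with
  | zero => simp
  | add x y hx hy => simp only [map_add, hx, hy]
  | tmul q d => simp [h]

end Star
end Forms

/-! ### Bundled structure maps of a bimodule and reformulation of the coaction axioms -/

section Bundled
variable {A B X : Type u} [Ring A] [Algebra ℂ A] [StarRing A]
  [Ring B] [Algebra ℂ B] [StarRing B] [AddCommGroup X] [Module ℂ X]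

namespace Bimod
variable (bm : Bimod A B X)

/-- The left action as a bilinear map. -/
def lsL : A →ₗ[ℂ] X →ₗ[ℂ] X :=
  LinearMap.mk₂ ℂ bm.ls bm.ls_add bm.ls_smul bm.ls_add' fun c a x => bm.ls_smul' c a x

/-- The right action as a bilinear map. -/
def rsL : X →ₗ[ℂ] B →ₗ[ℂ] X :=
  LinearMap.mk₂ ℂ bm.rs bm.rs_add' bm.rs_smul' bm.rs_add fun c x b => bm.rs_smul c x b

/-- The left inner product as a sesquilinear map. -/
def linnL : X →ₗ[ℂ] X →ₛₗ[starRingEnd ℂ] A :=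
  LinearMap.mk₂'ₛₗ (RingHom.id ℂ) (starRingEnd ℂ) bm.linn bm.linn_add_left bm.linn_smul_left
    bm.linn_add_right fun c x y => bm.linn_smul_right c x y

/-- The right inner product as a sesquilinear map. -/
def rinnL : X →ₛₗ[starRingEnd ℂ] X →ₗ[ℂ] B :=
  LinearMap.mk₂'ₛₗ (starRingEnd ℂ) (RingHom.id ℂ) bm.rinn bm.rinn_add_left bm.rinn_smul_left
    bm.rinn_add_right fun c x y => bm.rinn_smul_right c x y

@[simp] theorem lsL_apply (a : A) (x : X) : bm.lsL a x = bm.ls a x := rfl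
@[simp] theorem rsL_apply (x : X) (b : B) : bm.rsL x b = bm.rs x b := rfl
@[simp] theorem linnL_apply (x y : X) : bm.linnL x y = bm.linn x y := rfl
@[simp] theorem rinnL_apply (x y : X) : bm.rinnL x y = bm.rinn x y := rfl

end Bimod

/-- The star operation as a conjugate linear map. -/
def starL (A : Type*) [Ring A] [Algebra ℂ A] [StarRing A] [StarModule ℂ A] :
    A →ₛₗ[starRingEnd ℂ] A :=
  (starLinearEquiv ℂ (A := A)).toLinearMap

@[simp] theorem starL_apply (A : Type*) [Ring A] [Algebra ℂ A] [StarRing A] [StarModule ℂ A]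
    (a : A) : starL A a = star a := rfl

variable {H0 : Type u} [Ring H0] [Algebra ℂ H0] [StarRing H0] [StarModule ℂ H0]
  [FiniteDimensional ℂ H0]

theorem tstarWith_star [StarModule ℂ A] :
    tstarWith (C := H0) (star : A → A) = fun t => tensorStar H0 (starL A) t :=
  tstarWith_eq_tensorStar (starL A)

theorem tstarWith_tstarWith_star [StarModule ℂ A] :
    tstarWith (C := H0) (tstarWith (C := H0) (star : A → A))
      = fun t => tensorStar H0 (tensorStar H0 (starL A)) t := by
  rw [tstarWith_star, tstarWith_eq_tensorStar]

/-- The weak coaction axioms for a bimodule in terms of the bundled structure maps. -/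
theorem isWeakCoactionBimod_iff {ε0 : H0 →ₗ[ℂ] ℂ} {bm : Bimod A B X}
    {ρ : A →ₗ[ℂ] A ⊗[ℂ] H0} {σ : B →ₗ[ℂ] B ⊗[ℂ] H0} {lam : X →ₗ[ℂ] X ⊗[ℂ] H0} :
    IsWeakCoactionBimod ε0 bm ρ σ lam ↔
      (∀ a x, lam (bm.ls a x) = tensorAct H0 bm.lsL (ρ a) (lam x)) ∧
      (∀ x b, lam (bm.rs x b) = tensorAct H0 bm.rsL (lam x) (σ b)) ∧
      (∀ x y, ρ (bm.linn x y) = tensorInnL H0 bm.linnL (lam x) (lam y)) ∧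
      (∀ x y, σ (bm.rinn x y) = tensorInnR H0 bm.rinnL (lam x) (lam y)) ∧
      (∀ x, appRight ε0 (lam x) = x) := by
  have h₁ : tact (C := H0) bm.ls = fun s t => tensorAct H0 bm.lsL s t := tact_eq_tensorAct bm.lsL
  have h₂ : tact (C := H0) bm.rs = fun s t => tensorAct H0 bm.rsL s t := tact_eq_tensorAct bm.rsL
  have h₃ : tinnL (C := H0) bm.linn = fun s t => tensorInnL H0 bm.linnL s t :=
    funext₂ fun s t => tinnL_eq_tensorInnL bm.linnL s t
  have h₄ : tinnR (C := H0) bm.rinn = fun s t => tensorInnR H0 bm.rinnL s t :=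
    funext₂ fun s t => tinnR_eq_tensorInnR bm.rinnL s t
  refine ⟨fun h => ⟨?_, ?_, ?_, ?_, h.counital⟩, fun h => ⟨?_, ?_, ?_, ?_, h.2.2.2.2⟩⟩
  · simpa only [h₁] using h.ls_compat
  · simpa only [h₂] using h.rs_compat
  · simpa only [h₃] using h.linn_compat
  · simpa only [h₄] using h.rinn_compat
  · simpa only [h₁] using h.1
  · simpa only [h₂] using h.2.1
  · simpa only [h₃] using h.2.2.1
  · simpa only [h₄] using h.2.2.2.1

/-- The twisted coassociativity axiom for a bimodule in terms of the bundled structure maps. -/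
theorem isTwistedCoactionBimod_iff [StarModule ℂ B] {Δ0 : H0 →ₗ[ℂ] H0 ⊗[ℂ] H0} {ε0 : H0 →ₗ[ℂ] ℂ}
    {bm : Bimod A B X} {ρ : A →ₗ[ℂ] A ⊗[ℂ] H0} {u : (A ⊗[ℂ] H0) ⊗[ℂ] H0}
    {σ : B →ₗ[ℂ] B ⊗[ℂ] H0} {v : (B ⊗[ℂ] H0) ⊗[ℂ] H0} {lam : X →ₗ[ℂ] X ⊗[ℂ] H0} :
    IsTwistedCoactionBimod Δ0 ε0 bm ρ u σ v lam ↔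
      IsWeakCoactionBimod ε0 bm ρ σ lam ∧
      ∀ x, TensorProduct.map lam LinearMap.id (lam x)
        = tensorAct H0 (tensorAct H0 bm.rsL)
            (tensorAct H0 (tensorAct H0 bm.lsL) u (expand Δ0 (lam x)))
            (tensorStar H0 (tensorStar H0 (starL B)) v) := by
  have h₁ : tact (C := H0) (tact (C := H0) bm.ls)
      = fun s t => tensorAct H0 (tensorAct H0 bm.lsL) s t := by
    rw [show tact (C := H0) bm.ls = fun s t => tensorAct H0 bm.lsL s t from
      tact_eq_tensorAct bm.lsL, tact_eq_tensorAct]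
  have h₂ : tact (C := H0) (tact (C := H0) bm.rs)
      = fun s t => tensorAct H0 (tensorAct H0 bm.rsL) s t := by
    rw [show tact (C := H0) bm.rs = fun s t => tensorAct H0 bm.rsL s t from
      tact_eq_tensorAct bm.rsL, tact_eq_tensorAct]
  have h : ∀ x, tact (tact bm.rs) (tact (tact bm.ls) u
      ((TensorProduct.assoc ℂ X H0 H0).symm (TensorProduct.map LinearMap.id Δ0 (lam x))))
          (tstarWith (tstarWith star) v) = tensorAct H0 (tensorAct H0 bm.rsL)
            (tensorAct H0 (tensorAct H0 bm.lsL) u (expand Δ0 (lam x)))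
            (tensorStar H0 (tensorStar H0 (starL B)) v) := fun x => by
    rw [h₁, h₂, tstarWith_tstarWith_star]
    rfl
  refine ⟨fun H => ⟨H.toIsWeakCoactionBimod, fun x => ?_⟩, fun H => ⟨H.1, fun x => ?_⟩⟩
  · rw [← h, H.twisted]
  · rw [h, H.2]

theorem IsTwistedCoactionBimod.twisted' [StarModule ℂ B] {Δ0 : H0 →ₗ[ℂ] H0 ⊗[ℂ] H0}
    {ε0 : H0 →ₗ[ℂ] ℂ} {bm : Bimod A B X} {ρ : A →ₗ[ℂ] A ⊗[ℂ] H0} {u : (A ⊗[ℂ] H0) ⊗[ℂ] H0}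
    {σ : B →ₗ[ℂ] B ⊗[ℂ] H0} {v : (B ⊗[ℂ] H0) ⊗[ℂ] H0} {lam : X →ₗ[ℂ] X ⊗[ℂ] H0}
    (h : IsTwistedCoactionBimod Δ0 ε0 bm ρ u σ v lam) (x : X) :
    TensorProduct.map lam LinearMap.id (lam x)
        = tensorAct H0 (tensorAct H0 bm.rsL)
            (tensorAct H0 (tensorAct H0 bm.lsL) u (expand Δ0 (lam x)))
            (tensorStar H0 (tensorStar H0 (starL B)) v) :=
  (isTwistedCoactionBimod_iff.1 h).2 x

end Bundled

/-! ### Reflexivity -/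

section Refl
variable {A : Type u} [Ring A] [Algebra ℂ A] [StarRing A] [StarModule ℂ A]

/-- A ⋆-algebra as a bimodule over itself. -/
def Bimod.self (hA : ∀ a : A, star a * a = 0 → a = 0) : Bimod A A A where
  ls a x := a * x
  rs x a := x * a
  linn x y := x * star y
  rinn x y := star x * y
  ls_one := one_mul
  ls_mul := mul_assoc
  ls_add := add_mul
  ls_add' := mul_add
  ls_smul := smul_mul_assoc
  ls_smul' c a x := mul_smul_comm c a x
  rs_one := mul_one
  rs_mul x b b' := (mul_assoc x b b').symm
  rs_add := mul_add
  rs_add' := add_mul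
  rs_smul c x b := mul_smul_comm c x b
  rs_smul' := smul_mul_assoc
  ls_rs a x b := (mul_assoc a x b).symm
  linn_add_left x y z := add_mul x y _
  linn_add_right x y z := by rw [star_add, mul_add]
  rinn_add_left x y z := by rw [star_add, add_mul]
  rinn_add_right x y z := mul_add _ y z
  linn_smul_left c x y := smul_mul_assoc c x _
  linn_smul_right c x y := by rw [star_smul, mul_smul_comm]; rfl
  rinn_smul_left c x y := by rw [star_smul, smul_mul_assoc]; rfl
  rinn_smul_right c x y := mul_smul_comm c _ y
  linn_star x y := by simp
  rinn_star x y := by simp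
  linn_ls a x y := mul_assoc a x _
  rinn_rs x y b := (mul_assoc _ y b).symm
  linn_rs x y b := by simp [mul_assoc]
  rinn_ls a x y := by simp [mul_assoc]
  linn_pos x := ⟨star x, by simp⟩
  rinn_pos x := ⟨x, rfl⟩
  rinn_def := hA

theorem Bimod.self_isEquivalence (hA : ∀ a : A, star a * a = 0 → a = 0) :
    (Bimod.self hA).IsEquivalence := by
  refine ⟨fun x y z => mul_assoc x _ z, ?_, ?_⟩
  · refine Submodule.eq_top_iff'.2 fun a => Submodule.subset_span ⟨(a, 1), ?_⟩
    simp [Bimod.self]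
  · refine Submodule.eq_top_iff'.2 fun a => Submodule.subset_span ⟨(1, a), ?_⟩
    simp [Bimod.self]

variable {H0 : Type u} [Ring H0] [Algebra ℂ H0] [StarRing H0] [StarModule ℂ H0]
  [FiniteDimensional ℂ H0]

theorem IsTwistedCoaction.self {Δ0 : H0 →ₗ[ℂ] H0 ⊗[ℂ] H0} {ε0 : H0 →ₗ[ℂ] ℂ}
    {ρ : A →ₗ[ℂ] A ⊗[ℂ] H0} {u : (A ⊗[ℂ] H0) ⊗[ℂ] H0} (h : IsTwistedCoaction Δ0 ε0 ρ u)
    (hA : ∀ a : A, star a * a = 0 → a = 0) :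
    IsTwistedCoactionBimod Δ0 ε0 (Bimod.self hA) ρ u ρ u ρ := by
  have hl : (Bimod.self hA).lsL = LinearMap.mul ℂ A := rfl
  have hr : (Bimod.self hA).rsL = LinearMap.mul ℂ A := rfl
  have hs : ∀ a, ρ (star a) = tensorStar H0 (starL A) (ρ a) := fun a => by
    rw [h.map_star, tstarWith_star]
  refine isTwistedCoactionBimod_iff.2 ⟨isWeakCoactionBimod_iff.2 ⟨fun a x => ?_, fun x b => ?_,
    fun x y => ?_, fun x y => ?_, h.counital⟩, fun x => ?_⟩
  · rw [hl, tensorAct_mul]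
    exact h.map_mul a x
  · rw [hr, tensorAct_mul]
    exact h.map_mul x b
  · rw [tensorInnL_eq_tensorAct_star (g := LinearMap.mul ℂ A) (j := starL A) fun _ _ => rfl,
      tensorAct_mul, ← hs]
    exact h.map_mul x _
  · rw [tensorInnR_eq_tensorAct_star (g := LinearMap.mul ℂ A) (j := starL A) fun _ _ => rfl,
      tensorAct_mul, ← hs]
    exact h.map_mul _ y
  · rw [hl, hr, tensorAct_mul_eq, tensorAct_mul, tensorAct_mul, h.twisted_coassoc,
      tstarWith_tstarWith_star]
    rfl

end Refl

/-! ### Symmetry -/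

/-- The complex conjugate of a complex vector space. -/
def Conj (X : Type u) : Type u := X

instance (X : Type u) [AddCommGroup X] : AddCommGroup (Conj X) := inferInstanceAs (AddCommGroup X)

instance (X : Type u) [AddCommGroup X] [Module ℂ X] : Module ℂ (Conj X) :=
  Module.compHom X (starRingEnd ℂ)

section Conj
variable {A B X : Type u} [Ring A] [Algebra ℂ A] [StarRing A]
  [Ring B] [Algebra ℂ B] [StarRing B] [AddCommGroup X] [Module ℂ X]

variable (X) in
/-- The identity map from a space to its conjugate. -/
def toConj : X →ₛₗ[starRingEnd ℂ] Conj X where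
  toFun x := x
  map_add' _ _ := rfl
  map_smul' c x := by
    change c • x = (starRingEnd ℂ (starRingEnd ℂ c)) • x
    simp

variable (X) in
/-- The identity map to a space from its conjugate. -/
def ofConj : Conj X →ₛₗ[starRingEnd ℂ] X where
  toFun x := x
  map_add' _ _ := rfl
  map_smul' _ _ := rfl

@[simp] theorem ofConj_toConj (x : X) : ofConj X (toConj X x) = x := rfl
@[simp] theorem toConj_ofConj (x : Conj X) : toConj X (ofConj X x) = x := rfl

/-- The conjugate of a bimodule whose left inner product is definite. -/
def Bimod.conj [StarModule ℂ A] [StarModule ℂ B] (bm : Bimod A B X)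
    (hdef : ∀ x, bm.linn x x = 0 → x = 0) : Bimod B A (Conj X) where
  ls b x := toConj X (bm.rs (ofConj X x) (star b))
  rs x a := toConj X (bm.ls (star a) (ofConj X x))
  linn x y := bm.rinn (ofConj X x) (ofConj X y)
  rinn x y := bm.linn (ofConj X x) (ofConj X y)
  ls_one x := by simp [bm.rs_one]
  ls_mul a a' x := by simp [bm.rs_mul]
  ls_add a a' x := by simp [bm.rs_add]
  ls_add' a x y := by simp [bm.rs_add']
  ls_smul c a x := by simp [bm.rs_smul]
  ls_smul' c a x := by simp [bm.rs_smul']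
  rs_one x := by simp [bm.ls_one]
  rs_mul x b b' := by simp [bm.ls_mul]
  rs_add x b b' := by simp [bm.ls_add]
  rs_add' x y b := by simp [bm.ls_add']
  rs_smul c x b := by simp [bm.ls_smul]
  rs_smul' c x b := by simp [bm.ls_smul']
  ls_rs a x b := by simp [bm.ls_rs]
  linn_add_left x y z := by simp [bm.rinn_add_left]
  linn_add_right x y z := by simp [bm.rinn_add_right]
  rinn_add_left x y z := by simp [bm.linn_add_left]
  rinn_add_right x y z := by simp [bm.linn_add_right]
  linn_smul_left c x y := by simp [bm.rinn_smul_left]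
  linn_smul_right c x y := by simp [bm.rinn_smul_right]
  rinn_smul_left c x y := by simp [bm.linn_smul_left]
  rinn_smul_right c x y := by simp [bm.linn_smul_right]
  linn_star x y := bm.rinn_star _ _
  rinn_star x y := bm.linn_star _ _
  linn_ls a x y := by
    rw [ofConj_toConj, ← bm.rinn_star, bm.rinn_rs, star_mul, star_star, bm.rinn_star]
  rinn_rs x y b := by
    rw [ofConj_toConj, ← bm.linn_star, bm.linn_ls, star_mul, star_star, bm.linn_star]
  linn_rs x y b := by simp [bm.rinn_ls]
  rinn_ls a x y := by simp [bm.linn_rs]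
  linn_pos x := bm.rinn_pos _
  rinn_pos x := bm.linn_pos _
  rinn_def x h := hdef _ h

variable [StarModule ℂ A] [StarModule ℂ B]

theorem Bimod.conj_isEquivalence {bm : Bimod A B X} (h : bm.IsEquivalence)
    (hdef : ∀ x, bm.linn x x = 0 → x = 0) : (bm.conj hdef).IsEquivalence := by
  refine ⟨fun x y z => ?_, h.2.2, h.2.1⟩
  simp only [Bimod.conj, bm.rinn_star, bm.linn_star]
  rw [h.1]

variable {H0 : Type u} [Ring H0] [Algebra ℂ H0] [StarRing H0] [StarModule ℂ H0]
  [FiniteDimensional ℂ H0]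

/-- The map induced on the conjugate bimodule by a coaction-type map. -/
def conjCoact (lam : X →ₗ[ℂ] X ⊗[ℂ] H0) : Conj X →ₗ[ℂ] Conj X ⊗[ℂ] H0 :=
  (tensorStar H0 (toConj X)).comp (lam.comp (ofConj X))

theorem conjCoact_apply (lam : X →ₗ[ℂ] X ⊗[ℂ] H0) (x : Conj X) :
    conjCoact lam x = tensorStar H0 (toConj X) (lam (ofConj X x)) := rfl

theorem map_conjCoact_tensorStar (lam : X →ₗ[ℂ] X ⊗[ℂ] H0) (t : X ⊗[ℂ] H0) :
    TensorProduct.map (conjCoact lam) LinearMap.id (tensorStar H0 (toConj X) t)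
      = tensorStar H0 (tensorStar H0 (toConj X)) (TensorProduct.map lam LinearMap.id t) := by
  induction t using TensorProduct.induction_on with
  | zero => simp
  | add x y hx hy => simp only [map_add, hx, hy]
  | tmul p c => simp [conjCoact_apply]

theorem appRight_tensorStar {P Q : Type*} [AddCommGroup P] [Module ℂ P] [AddCommGroup Q]
    [Module ℂ Q] {ε0 : H0 →ₗ[ℂ] ℂ} (hε : ∀ h, ε0 (star h) = starRingEnd ℂ (ε0 h))
    (f : P →ₛₗ[starRingEnd ℂ] Q) (t : P ⊗[ℂ] H0) :
    appRight ε0 (tensorStar H0 f t) = f (appRight ε0 t) := by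
  induction t using TensorProduct.induction_on with
  | zero => simp
  | add x y hx hy => simp only [map_add, hx, hy]
  | tmul p c => simp [appRight_tmul, hε]

theorem tensorInnL_conj {bm : Bimod A B X} (hdef : ∀ x, bm.linn x x = 0 → x = 0)
    (s t : X ⊗[ℂ] H0) :
    tensorInnL H0 (bm.conj hdef).linnL (tensorStar H0 (toConj X) s) (tensorStar H0 (toConj X) t)
      = tensorInnR H0 bm.rinnL s t := by
  induction s using TensorProduct.induction_on with
  | zero => simp
  | add x y hx hy => simp only [map_add, LinearMap.add_apply, hx, hy]
  | tmul p c =>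
  induction t using TensorProduct.induction_on with
  | zero => simp
  | add x y hx hy => simp only [map_add, hx, hy]
  | tmul q d => simp [Bimod.conj]

theorem tensorInnR_conj {bm : Bimod A B X} (hdef : ∀ x, bm.linn x x = 0 → x = 0)
    (s t : X ⊗[ℂ] H0) :
    tensorInnR H0 (bm.conj hdef).rinnL (tensorStar H0 (toConj X) s) (tensorStar H0 (toConj X) t)
      = tensorInnL H0 bm.linnL s t := by
  induction s using TensorProduct.induction_on with
  | zero => simp
  | add x y hx hy => simp only [map_add, LinearMap.add_apply, hx, hy]
  | tmul p c =>
  induction t using TensorProduct.induction_on with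
  | zero => simp
  | add x y hx hy => simp only [map_add, hx, hy]
  | tmul q d => simp [Bimod.conj]

theorem tensorStar_tensorStar_star (t : (A ⊗[ℂ] H0) ⊗[ℂ] H0) :
    tensorStar H0 (tensorStar H0 (starL A)) (tensorStar H0 (tensorStar H0 (starL A)) t) = t :=
  tensorStar_involutive (tensorStar_involutive fun a => star_star a) t

theorem IsTwistedCoactionBimod.conj {Δ0 : H0 →ₗ[ℂ] H0 ⊗[ℂ] H0} {ε0 : H0 →ₗ[ℂ] ℂ}
    {bm : Bimod A B X} {ρ : A →ₗ[ℂ] A ⊗[ℂ] H0} {u : (A ⊗[ℂ] H0) ⊗[ℂ] H0}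
    {σ : B →ₗ[ℂ] B ⊗[ℂ] H0} {v : (B ⊗[ℂ] H0) ⊗[ℂ] H0} {lam : X →ₗ[ℂ] X ⊗[ℂ] H0}
    (h : IsTwistedCoactionBimod Δ0 ε0 bm ρ u σ v lam)
    (hρ : IsWeakCoaction ε0 ρ) (hσ : IsWeakCoaction ε0 σ)
    (hΔ : ∀ h, Δ0 (star h) = tensorStar H0 (starL H0) (Δ0 h))
    (hε : ∀ h, ε0 (star h) = starRingEnd ℂ (ε0 h))
    (hdef : ∀ x, bm.linn x x = 0 → x = 0) :
    IsTwistedCoactionBimod Δ0 ε0 (bm.conj hdef) σ v ρ u (conjCoact lam) := by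
  obtain ⟨h₁, h₂, h₃, h₄, h₅⟩ := isWeakCoactionBimod_iff.1 h.toIsWeakCoactionBimod
  have hρs : ∀ a, ρ (star a) = tensorStar H0 (starL A) (ρ a) := fun a => by
    rw [hρ.map_star, tstarWith_star]
  have hσs : ∀ a, σ (star a) = tensorStar H0 (starL B) (σ a) := fun a => by
    rw [hσ.map_star, tstarWith_star]
  have hl : ∀ (a : A) (x : X), toConj X (bm.lsL a x)
      = (bm.conj hdef).rsL (toConj X x) (starL A a) := fun a x => by simp [Bimod.conj]
  have hr : ∀ (x : X) (b : B), toConj X (bm.rsL x b)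
      = (bm.conj hdef).lsL (starL B b) (toConj X x) := fun x b => by simp [Bimod.conj]
  refine isTwistedCoactionBimod_iff.2 ⟨isWeakCoactionBimod_iff.2 ⟨fun b x => ?_, fun x a => ?_,
    fun x y => ?_, fun x y => ?_, fun x => ?_⟩, fun x => ?_⟩
  · change tensorStar H0 (toConj X) (lam (bm.rs (ofConj X x) (star b))) = _
    rw [h₂, tensorStar_tensorAct hr, hσs, tensorStar_involutive fun a => star_star a]
    rfl
  · change tensorStar H0 (toConj X) (lam (bm.ls (star a) (ofConj X x))) = _
    rw [h₁, tensorStar_tensorAct hl, hρs, tensorStar_involutive fun a => star_star a]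
    rfl
  · rw [conjCoact_apply, conjCoact_apply, tensorInnL_conj, ← h₄]
    rfl
  · rw [conjCoact_apply, conjCoact_apply, tensorInnR_conj, ← h₃]
    rfl
  · rw [conjCoact_apply, appRight_tensorStar hε, h₅, toConj_ofConj]
  · rw [conjCoact_apply, map_conjCoact_tensorStar, h.twisted',
      tensorStar_tensorAct fun s t => tensorStar_tensorAct hr s t,
      tensorStar_tensorAct fun s t => tensorStar_tensorAct hl s t,
      tensorStar_tensorStar_star, expand_tensorStar Δ0 hΔ]
    refine (tensorAct_assoc (fun b x a => tensorAct_assoc (fun b x a => ?_) b x a) _ _ _).symm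
    exact ((bm.conj hdef).ls_rs b x a).symm

end Conj

/-! ### Finite bases of equivalence bimodules -/

section Basis
variable {A B X : Type u} [CStarAlgebra A] [CStarAlgebra B] [AddCommGroup X] [Module ℂ X]

theorem Bimod.linn_definite (bm : Bimod A B X) (h : bm.IsEquivalence) (x : X)
    (hx : bm.linn x x = 0) : x = 0 := by
  refine bm.rinn_def x (CStarRing.star_mul_self_eq_zero_iff _ |>.1 ?_)
  have hz : bm.rs x (bm.rinn x x) = 0 := by
    rw [← h.1, hx]
    exact map_zero (bm.lsL.flip x)
  rw [bm.rinn_star, ← bm.rinn_rs, hz]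
  exact map_zero (bm.rinnL x)

theorem Bimod.linn_polarization (bm : Bimod A B X) (x y : X) :
    bm.linn x y + bm.linn y x
      = (2⁻¹ : ℂ) • (bm.linn (x + y) (x + y) - bm.linn (x - y) (x - y)) := by
  simp only [← bm.linnL_apply, map_add, map_sub, LinearMap.add_apply, LinearMap.sub_apply]
  module

theorem exists_sum_star_mul_self {ι : Type*} (s : Finset ι) (f : ι → A)
    (hf : ∀ i ∈ s, ∃ a, f i = star a * a) : ∃ a, ∑ i ∈ s, f i = star a * a := by
  let _ := CStarAlgebra.spectralOrder A
  have _ := CStarAlgebra.spectralOrderedRing A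
  refine CStarAlgebra.nonneg_iff_eq_star_mul_self.1 (Finset.sum_nonneg fun i hi => ?_)
  exact CStarAlgebra.nonneg_iff_eq_star_mul_self.2 (hf i hi)

theorem eq_zero_of_sum_star_mul_self {ι : Type*} (s : Finset ι) (f : ι → A)
    (hf : ∀ i ∈ s, ∃ a, f i = star a * a) (h : ∑ i ∈ s, f i = 0) : ∀ i ∈ s, f i = 0 := by
  let _ := CStarAlgebra.spectralOrder A
  have _ := CStarAlgebra.spectralOrderedRing A
  exact (Finset.sum_eq_zero_iff_of_nonneg fun i hi =>
    CStarAlgebra.nonneg_iff_eq_star_mul_self.2 (hf i hi)).1 h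

/-- If the left inner product is full, the unit is a finite sum of inner squares. -/
theorem Bimod.exists_sum_linn_eq_one (bm : Bimod A B X)
    (h : Submodule.span ℂ (Set.range fun p : X × X => bm.linn p.1 p.2) = ⊤) :
    ∃ (n : ℕ) (u : Fin n → X), ∑ i, bm.linn (u i) (u i) = 1 := by
  let _ := CStarAlgebra.spectralOrder A
  have _ := CStarAlgebra.spectralOrderedRing A
  have hnn : ∀ x, 0 ≤ bm.linn x x := fun x =>
    CStarAlgebra.nonneg_iff_eq_star_mul_self.2 (bm.linn_pos x)
  have h1 : (1 : A) ∈ Submodule.span ℂ (Set.range fun p : X × X => bm.linn p.1 p.2) := by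
    rw [h]; trivial
  obtain ⟨n, c, g, hg⟩ := Submodule.mem_span_set'.1 h1
  choose p hp using fun i => (g i).2
  have hsum : ∑ i, bm.linn (c i • (p i).1) (p i).2 = 1 := by
    rw [← hg]
    exact Finset.sum_congr rfl fun i _ => by rw [bm.linn_smul_left, ← hp i]
  set x : Fin n → X := fun i => c i • (p i).1 with hx
  set y : Fin n → X := fun i => (p i).2 with hy
  have hsum' : ∑ i, bm.linn (y i) (x i) = 1 := by
    have := congrArg star hsum
    simpa only [star_sum, bm.linn_star, star_one] using this
  set r : Fin n → X := fun i => (2⁻¹ : ℂ) • (x i + y i) with hr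
  set q : Fin n → X := fun i => (2⁻¹ : ℂ) • (x i - y i) with hq
  have hrq : ∑ i, bm.linn (r i) (r i) = 1 + ∑ i, bm.linn (q i) (q i) := by
    have : ∀ i, bm.linn (r i) (r i)
        = (2⁻¹ : ℂ) • (bm.linn (x i) (y i) + bm.linn (y i) (x i)) + bm.linn (q i) (q i) := by
      intro i
      rw [bm.linn_polarization]
      simp only [hr, hq, bm.linn_smul_left, bm.linn_smul_right, map_inv₀, map_ofNat]
      module
    rw [Finset.sum_congr rfl fun i _ => this i, Finset.sum_add_distrib, ← Finset.smul_sum,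
      Finset.sum_add_distrib, hsum, hsum']
    congr 1
    module
  set T : A := ∑ i, bm.linn (r i) (r i) with hT
  have hle : (1 : A) ≤ T := by
    rw [hrq]
    exact le_add_of_nonneg_right (Finset.sum_nonneg fun i _ => hnn _)
  have hT0 : 0 ≤ T := Finset.sum_nonneg fun i _ => hnn _
  obtain ⟨U, hU⟩ : IsUnit T := CStarAlgebra.isUnit_of_le 1 hle
  have hTs : star T = T := hT0.isSelfAdjoint.star_eq
  have hUs : star (↑U⁻¹ : A) = ↑U⁻¹ := by
    have : star U = U := Units.ext (by rw [Units.coe_star, hU, hTs])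
    rw [← Units.coe_star, star_inv, this]
  obtain ⟨t, hts, htt⟩ : ∃ t : A, star t = t ∧ t * t = U :=
    ⟨CFC.sqrt T, (CFC.sqrt_nonneg T).isSelfAdjoint.star_eq,
      by rw [CFC.sqrt_mul_sqrt_self T hT0, hU]⟩
  have hconj : ∀ (a : A) (z : X), bm.linn (bm.ls a z) (bm.ls a z) = a * bm.linn z z * star a := by
    intro a z
    rw [bm.linn_ls, ← bm.linn_star, bm.linn_ls, star_mul, bm.linn_star, mul_assoc]
  refine ⟨n, fun i => bm.ls (↑U⁻¹ * t) (r i), ?_⟩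
  simp only [hconj]
  rw [← Finset.sum_mul, ← Finset.mul_sum, ← hT, star_mul, hUs, hts, ← hU, ← htt]
  calc ↑U⁻¹ * t * (t * t) * (t * ↑U⁻¹) = ↑U⁻¹ * ((t * t) * (t * t)) * ↑U⁻¹ := by
        simp only [mul_assoc]
    _ = 1 := by
        rw [htt]
        simp

/-- An equivalence bimodule over unital C*-algebras is of finite type. -/
theorem Bimod.IsEquivalence.finiteType {bm : Bimod A B X} (h : bm.IsEquivalence) :
    bm.FiniteType := by
  constructor
  · obtain ⟨n, u, hu⟩ := bm.exists_sum_linn_eq_one h.2.1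
    refine ⟨n, u, fun x => ?_⟩
    simp only [← h.1]
    simpa [bm.ls_one] using congrArg (fun a => bm.lsL a x) hu
  · obtain ⟨n, u, hu⟩ := (bm.conj (bm.linn_definite h)).exists_sum_linn_eq_one h.2.2
    refine ⟨n, fun i => ofConj X (u i), fun x => ?_⟩
    simp only [h.1]
    have hu' : ∑ i, bm.rinn (ofConj X (u i)) (ofConj X (u i)) = 1 := hu
    simpa [bm.rs_one] using congrArg (fun b => bm.rsL x b) hu'

end Basis

/-! ### The interior tensor product -/

section Interior
variable {A B C X Y : Type u} [Ring A] [Algebra ℂ A] [StarRing A]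
  [Ring B] [Algebra ℂ B] [StarRing B] [Ring C] [Algebra ℂ C] [StarRing C]
  [AddCommGroup X] [Module ℂ X] [AddCommGroup Y] [Module ℂ Y]

/-- The relations `x b ⊗ y = x ⊗ b y`. -/
def balancedRel (bmX : Bimod A B X) (bmY : Bimod B C Y) : Submodule ℂ (X ⊗[ℂ] Y) :=
  Submodule.span ℂ (Set.range fun p : X × B × Y =>
    bmX.rs p.1 p.2.1 ⊗ₜ[ℂ] p.2.2 - p.1 ⊗ₜ[ℂ] bmY.ls p.2.1 p.2.2)

/-- The algebraic tensor product `X ⊗_B Y`. -/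
abbrev Interior (bmX : Bimod A B X) (bmY : Bimod B C Y) : Type u :=
  (X ⊗[ℂ] Y) ⧸ balancedRel bmX bmY

namespace Interior
variable (bmX : Bimod A B X) (bmY : Bimod B C Y)

/-- The canonical balanced bilinear map `X × Y → X ⊗_B Y`. -/
def mk : X →ₗ[ℂ] Y →ₗ[ℂ] Interior bmX bmY :=
  (TensorProduct.mk ℂ X Y).compr₂ (balancedRel bmX bmY).mkQ

theorem mk_balanced (x : X) (b : B) (y : Y) :
    mk bmX bmY (bmX.rs x b) y = mk bmX bmY x (bmY.ls b y) :=
  (Submodule.Quotient.eq _).2 (Submodule.subset_span ⟨(x, b, y), rfl⟩)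

variable {bmX bmY}

@[elab_as_elim]
theorem induction {p : Interior bmX bmY → Prop} (z : Interior bmX bmY) (h0 : p 0)
    (hmk : ∀ x y, p (mk bmX bmY x y)) (hadd : ∀ z z', p z → p z' → p (z + z')) : p z := by
  obtain ⟨t, rfl⟩ := Submodule.mkQ_surjective _ z
  induction t using TensorProduct.induction_on with
  | zero => simpa using h0
  | tmul x y => exact hmk x y
  | add s t hs ht => simpa using hadd _ _ hs ht

theorem span_mk :
    Submodule.span ℂ (Set.range fun p : X × Y => mk bmX bmY p.1 p.2) = ⊤ := by
  refine Submodule.eq_top_iff'.2 fun z => ?_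
  induction z using Interior.induction with
  | h0 => exact Submodule.zero_mem _
  | hmk x y => exact Submodule.subset_span ⟨(x, y), rfl⟩
  | hadd z z' h h' => exact Submodule.add_mem _ h h'

variable {σ : ℂ →+* ℂ} {N : Type*} [AddCommGroup N] [Module ℂ N]

/-- A balanced (semi)bilinear map factors through the interior tensor product. -/
def lift (f : X →ₛₗ[σ] Y →ₛₗ[σ] N) (hf : ∀ x b y, f (bmX.rs x b) y = f x (bmY.ls b y)) :
    Interior bmX bmY →ₛₗ[σ] N :=
  (balancedRel bmX bmY).liftQ (TensorProduct.lift f) <| by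
    refine Submodule.span_le.2 ?_
    rintro _ ⟨⟨x, b, y⟩, rfl⟩
    simp [hf]

@[simp]
theorem lift_mk (f : X →ₛₗ[σ] Y →ₛₗ[σ] N) (hf : ∀ x b y, f (bmX.rs x b) y = f x (bmY.ls b y))
    (x : X) (y : Y) : lift f hf (mk bmX bmY x y) = f x y := rfl

theorem hom_ext {f g : Interior bmX bmY →ₛₗ[σ] N}
    (h : ∀ x y, f (mk bmX bmY x y) = g (mk bmX bmY x y)) : f = g := by
  refine LinearMap.ext fun z => ?_
  induction z using Interior.induction with
  | h0 => simp
  | hmk x y => exact h x y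
  | hadd z z' h h' => simp only [map_add, h, h']

variable (bmX bmY)

/-- The left action on the interior tensor product. -/
def lsZ : A →ₗ[ℂ] Interior bmX bmY →ₗ[ℂ] Interior bmX bmY where
  toFun a := lift ((mk bmX bmY).comp (bmX.lsL a)) fun x b y => by
    simp [bmX.ls_rs, mk_balanced]
  map_add' a a' := hom_ext fun x y => by
    change mk bmX bmY (bmX.lsL (a + a') x) y = mk bmX bmY (bmX.lsL a x) y + _
    rw [map_add, LinearMap.add_apply, map_add]
    rfl
  map_smul' c a := hom_ext fun x y => by
    change mk bmX bmY (bmX.lsL (c • a) x) y = c • mk bmX bmY (bmX.lsL a x) y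
    rw [map_smul, LinearMap.smul_apply, map_smul]
    rfl

/-- The right action on the interior tensor product. -/
def rsZ : Interior bmX bmY →ₗ[ℂ] C →ₗ[ℂ] Interior bmX bmY := LinearMap.flip
  { toFun c := lift ((mk bmX bmY).compl₂ (bmY.rsL.flip c)) fun x b y => by
      simp [← bmY.ls_rs, mk_balanced]
    map_add' c c' := hom_ext fun x y => by
      rw [LinearMap.add_apply, lift_mk, lift_mk, lift_mk]
      simp
    map_smul' c a := hom_ext fun x y => by
      rw [LinearMap.smul_apply, lift_mk, lift_mk]
      simp }

@[simp] theorem lsZ_mk (a : A) (x : X) (y : Y) :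
    lsZ bmX bmY a (mk bmX bmY x y) = mk bmX bmY (bmX.ls a x) y := rfl

@[simp] theorem rsZ_mk (x : X) (y : Y) (c : C) :
    rsZ bmX bmY (mk bmX bmY x y) c = mk bmX bmY x (bmY.rs y c) := rfl

/-- The map `x ⊗ y ↦ ⟨u, x⟩ y`. -/
def leftCoef (u : X) : Interior bmX bmY →ₗ[ℂ] Y :=
  lift (bmY.lsL.comp (bmX.rinnL u)) fun x b y => by simp [bmX.rinn_rs, bmY.ls_mul]

/-- The map `x ⊗ y ↦ x ⟨y, v⟩`. -/
def rightCoef (v : Y) : Interior bmX bmY →ₗ[ℂ] X :=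
  lift (bmX.rsL.compl₂ (bmY.linnL.flip v)) fun x b y => by simp [bmY.linn_ls, bmX.rs_mul]

@[simp] theorem leftCoef_mk (u x : X) (y : Y) :
    leftCoef bmX bmY u (mk bmX bmY x y) = bmY.ls (bmX.rinn u x) y := rfl

@[simp] theorem rightCoef_mk (v : Y) (x : X) (y : Y) :
    rightCoef bmX bmY v (mk bmX bmY x y) = bmX.rs x (bmY.linn y v) := rfl

/-- The left inner product on the interior tensor product. -/
def linnZ : Interior bmX bmY →ₗ[ℂ] Interior bmX bmY →ₛₗ[starRingEnd ℂ] A := LinearMap.flip <|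
  lift (LinearMap.mk₂'ₛₗ (starRingEnd ℂ) (starRingEnd ℂ)
    (fun x' y' => (bmX.linnL.flip x').comp (rightCoef bmX bmY y'))
    (fun x x' y => by ext z; simp)
    (fun c x y => by ext z; simp)
    (fun x y y' => by
      refine hom_ext fun x' y' => ?_
      simp [bmY.linn_add_right, bmX.rs_add])
    (fun c x y => by
      refine hom_ext fun x' y' => ?_
      simp [bmY.linn_smul_right, bmX.rs_smul]))
  fun x b y => by
    refine hom_ext fun x' y' => ?_
    simp only [LinearMap.mk₂'ₛₗ_apply, LinearMap.comp_apply, LinearMap.flip_apply, rightCoef_mk,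
      Bimod.linnL_apply]
    rw [← bmY.linn_star (bmY.ls b y), bmY.linn_ls, star_mul, bmY.linn_star, bmX.rs_mul,
      bmX.linn_rs (bmX.rs x' _), star_star]

/-- The right inner product on the interior tensor product. -/
def rinnZ : Interior bmX bmY →ₛₗ[starRingEnd ℂ] Interior bmX bmY →ₗ[ℂ] C :=
  lift (LinearMap.mk₂'ₛₗ (starRingEnd ℂ) (starRingEnd ℂ)
    (fun x y => (bmY.rinnL y).comp (leftCoef bmX bmY x))
    (fun x x' y => by
      refine hom_ext fun x' y' => ?_
      simp [bmX.rinn_add_left, bmY.ls_add, bmY.rinn_add_right])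
    (fun c x y => by
      refine hom_ext fun x' y' => ?_
      simp [bmX.rinn_smul_left, bmY.ls_smul])
    (fun x y y' => by ext z; simp)
    (fun c x y => by ext z; simp))
  fun x b y => by
    refine hom_ext fun x' y' => ?_
    simp only [LinearMap.mk₂'ₛₗ_apply, LinearMap.comp_apply, leftCoef_mk, Bimod.rinnL_apply]
    rw [← bmX.rinn_star, bmX.rinn_rs, star_mul, bmX.rinn_star, bmY.ls_mul, bmY.rinn_ls]

theorem linnZ_apply_mk (z : Interior bmX bmY) (x : X) (y : Y) :
    linnZ bmX bmY z (mk bmX bmY x y) = bmX.linn (rightCoef bmX bmY y z) x := rfl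

theorem rinnZ_mk_apply (x : X) (y : Y) (z : Interior bmX bmY) :
    rinnZ bmX bmY (mk bmX bmY x y) z = bmY.rinn y (leftCoef bmX bmY x z) := rfl

@[simp] theorem linnZ_mk (x x' : X) (y y' : Y) :
    linnZ bmX bmY (mk bmX bmY x y) (mk bmX bmY x' y')
      = bmX.linn (bmX.rs x (bmY.linn y y')) x' := rfl

@[simp] theorem rinnZ_mk (x x' : X) (y y' : Y) :
    rinnZ bmX bmY (mk bmX bmY x y) (mk bmX bmY x' y')
      = bmY.rinn y (bmY.ls (bmX.rinn x x') y') := rfl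

theorem sum_mk_leftCoef {n : ℕ} {u : Fin n → X} (hu : ∀ x, ∑ i, bmX.rs (u i) (bmX.rinn (u i) x) = x)
    (z : Interior bmX bmY) : ∑ i, mk bmX bmY (u i) (leftCoef bmX bmY (u i) z) = z := by
  induction z using Interior.induction with
  | h0 => simp
  | hmk x y =>
    simp only [leftCoef_mk, ← mk_balanced]
    conv_rhs => rw [← hu x, map_sum, LinearMap.sum_apply]
  | hadd z z' h h' => simp only [map_add, Finset.sum_add_distrib, h, h']

theorem sum_mk_rightCoef {n : ℕ} {v : Fin n → Y} (hv : ∀ y, ∑ j, bmY.ls (bmY.linn y (v j)) (v j) = y)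
    (z : Interior bmX bmY) : ∑ i, mk bmX bmY (rightCoef bmX bmY (v i) z) (v i) = z := by
  induction z using Interior.induction with
  | h0 => simp
  | hmk x y =>
    simp only [rightCoef_mk, mk_balanced]
    conv_rhs => rw [← hv y, map_sum]
  | hadd z z' h h' =>
    simp only [map_add, LinearMap.add_apply, Finset.sum_add_distrib, h, h']

theorem rinnZ_self_eq_sum {n : ℕ} {u : Fin n → X}
    (hu : ∀ x, ∑ i, bmX.rs (u i) (bmX.rinn (u i) x) = x) (z : Interior bmX bmY) :
    rinnZ bmX bmY z z
      = ∑ i, bmY.rinn (leftCoef bmX bmY (u i) z) (leftCoef bmX bmY (u i) z) := by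
  conv_lhs => enter [1]; rw [← sum_mk_leftCoef bmX bmY hu z]
  simp only [map_sum, LinearMap.sum_apply, rinnZ_mk_apply]

theorem linnZ_self_eq_sum {n : ℕ} {v : Fin n → Y}
    (hv : ∀ y, ∑ j, bmY.ls (bmY.linn y (v j)) (v j) = y) (z : Interior bmX bmY) :
    linnZ bmX bmY z z
      = ∑ i, bmX.linn (rightCoef bmX bmY (v i) z) (rightCoef bmX bmY (v i) z) := by
  conv_lhs => enter [2]; rw [← sum_mk_rightCoef bmX bmY hv z]
  simp only [map_sum, linnZ_apply_mk]

end Interior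
end Interior

section InteriorBimod
variable {A B C X Y : Type u} [CStarAlgebra A] [CStarAlgebra B] [CStarAlgebra C]
  [AddCommGroup X] [Module ℂ X] [AddCommGroup Y] [Module ℂ Y]

open Interior in
/-- The interior tensor product of two bimodules of finite type over unital C*-algebras. -/
def Bimod.interior (bmX : Bimod A B X) (bmY : Bimod B C Y) (hX : bmX.FiniteType)
    (hY : bmY.FiniteType) : Bimod A C (Interior bmX bmY) where
  ls a z := lsZ bmX bmY a z
  rs z c := rsZ bmX bmY z c
  linn z z' := linnZ bmX bmY z z'
  rinn z z' := rinnZ bmX bmY z z'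
  ls_one z := by
    induction z using Interior.induction with
    | h0 => simp
    | hmk x y => simp [bmX.ls_one]
    | hadd z z' h h' => simp only [map_add, h, h']
  ls_mul a a' z := by
    induction z using Interior.induction with
    | h0 => simp
    | hmk x y => simp [bmX.ls_mul]
    | hadd z z' h h' => simp only [map_add, h, h']
  ls_add a a' z := by simp
  ls_add' a z z' := by simp
  ls_smul c a z := by simp
  ls_smul' c a z := by simp
  rs_one z := by
    induction z using Interior.induction with
    | h0 => simp
    | hmk x y => simp [bmY.rs_one]
    | hadd z z' h h' => simp only [map_add, LinearMap.add_apply, h, h']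
  rs_mul z b b' := by
    induction z using Interior.induction with
    | h0 => simp
    | hmk x y => simp [bmY.rs_mul]
    | hadd z z' h h' => simp only [map_add, LinearMap.add_apply, h, h']
  rs_add z b b' := by simp
  rs_add' z z' b := by simp
  rs_smul c z b := by simp
  rs_smul' c z b := by simp
  ls_rs a z c := by
    induction z using Interior.induction with
    | h0 => simp
    | hmk x y => simp
    | hadd z z' h h' => simp only [map_add, LinearMap.add_apply, h, h']
  linn_add_left x y z := by simp
  linn_add_right x y z := by simp
  rinn_add_left x y z := by simp
  rinn_add_right x y z := by simp
  linn_smul_left c x y := by simp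
  linn_smul_right c x y := by simp
  rinn_smul_left c x y := by simp
  rinn_smul_right c x y := by simp
  linn_star z z' := by
    induction z using Interior.induction with
    | h0 => simp
    | hadd z₁ z₂ h₁ h₂ => simp only [map_add, LinearMap.add_apply, star_add, h₁, h₂]
    | hmk x y =>
    induction z' using Interior.induction with
    | h0 => simp
    | hadd z₁ z₂ h₁ h₂ => simp only [map_add, LinearMap.add_apply, star_add, h₁, h₂]
    | hmk x' y' => simp [bmX.linn_star, bmX.linn_rs, bmY.linn_star]
  rinn_star z z' := by
    induction z using Interior.induction with
    | h0 => simp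
    | hadd z₁ z₂ h₁ h₂ => simp only [map_add, LinearMap.add_apply, star_add, h₁, h₂]
    | hmk x y =>
    induction z' using Interior.induction with
    | h0 => simp
    | hadd z₁ z₂ h₁ h₂ => simp only [map_add, LinearMap.add_apply, star_add, h₁, h₂]
    | hmk x' y' => simp [bmY.rinn_star, bmY.rinn_ls, bmX.rinn_star]
  linn_ls a z z' := by
    induction z using Interior.induction with
    | h0 => simp
    | hadd z₁ z₂ h₁ h₂ => simp only [map_add, LinearMap.add_apply, mul_add, h₁, h₂]
    | hmk x y =>
    induction z' using Interior.induction with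
    | h0 => simp
    | hadd z₁ z₂ h₁ h₂ => simp only [map_add, mul_add, h₁, h₂]
    | hmk x' y' => simp [← bmX.ls_rs, bmX.linn_ls]
  rinn_rs z z' c := by
    induction z using Interior.induction with
    | h0 => simp
    | hadd z₁ z₂ h₁ h₂ => simp only [map_add, LinearMap.add_apply, add_mul, h₁, h₂]
    | hmk x y =>
    induction z' using Interior.induction with
    | h0 => simp
    | hadd z₁ z₂ h₁ h₂ => simp only [map_add, LinearMap.add_apply, add_mul, h₁, h₂]
    | hmk x' y' => simp [bmY.ls_rs, bmY.rinn_rs]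
  linn_rs z z' c := by
    induction z using Interior.induction with
    | h0 => simp
    | hadd z₁ z₂ h₁ h₂ => simp only [map_add, LinearMap.add_apply, h₁, h₂]
    | hmk x y =>
    induction z' using Interior.induction with
    | h0 => simp
    | hadd z₁ z₂ h₁ h₂ => simp only [map_add, LinearMap.add_apply, h₁, h₂]
    | hmk x' y' => simp [bmY.linn_rs]
  rinn_ls a z z' := by
    induction z using Interior.induction with
    | h0 => simp
    | hadd z₁ z₂ h₁ h₂ => simp only [map_add, LinearMap.add_apply, h₁, h₂]
    | hmk x y =>
    induction z' using Interior.induction with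
    | h0 => simp
    | hadd z₁ z₂ h₁ h₂ => simp only [map_add, h₁, h₂]
    | hmk x' y' => simp [bmX.rinn_ls]
  linn_pos z := by
    obtain ⟨m, v, hv⟩ := hY.2
    rw [linnZ_self_eq_sum bmX bmY hv]
    exact exists_sum_star_mul_self _ _ fun i _ => bmX.linn_pos _
  rinn_pos z := by
    obtain ⟨n, u, hu⟩ := hX.1
    rw [rinnZ_self_eq_sum bmX bmY hu]
    exact exists_sum_star_mul_self _ _ fun i _ => bmY.rinn_pos _
  rinn_def z hz := by
    obtain ⟨n, u, hu⟩ := hX.1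
    rw [rinnZ_self_eq_sum bmX bmY hu] at hz
    have h := eq_zero_of_sum_star_mul_self _ _ (fun i _ => bmY.rinn_pos _) hz
    rw [← sum_mk_leftCoef bmX bmY hu z]
    exact Finset.sum_eq_zero fun i hi => by rw [bmY.rinn_def _ (h i hi), map_zero]

open Interior in
theorem Bimod.interior_isEquivalence {bmX : Bimod A B X} {bmY : Bimod B C Y}
    (hX : bmX.IsEquivalence) (hY : bmY.IsEquivalence) :
    (bmX.interior bmY hX.finiteType hY.finiteType).IsEquivalence := by
  refine ⟨fun z z' z'' => ?_, ?_, ?_⟩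
  · change lsZ bmX bmY (linnZ bmX bmY z z') z'' = rsZ bmX bmY z (rinnZ bmX bmY z' z'')
    induction z using Interior.induction with
    | h0 => simp only [map_zero, LinearMap.zero_apply]
    | hadd z₁ z₂ h₁ h₂ => simp only [map_add, LinearMap.add_apply, h₁, h₂]
    | hmk x y =>
    induction z' using Interior.induction with
    | h0 => simp only [map_zero, LinearMap.zero_apply]
    | hadd z₁ z₂ h₁ h₂ => simp only [map_add, LinearMap.add_apply, h₁, h₂]
    | hmk x' y' =>
    induction z'' using Interior.induction with
    | h0 => simp only [map_zero]
    | hadd z₁ z₂ h₁ h₂ => simp only [map_add, h₁, h₂]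
    | hmk x'' y'' => simp [hX.1, ← hY.1, mk_balanced]
  · rw [eq_top_iff, ← hX.2.1, Submodule.span_le]
    rintro _ ⟨⟨x, x'⟩, rfl⟩
    have h : Submodule.span ℂ (Set.range fun p : Y × Y => bmY.linn p.1 p.2) ≤
        (Submodule.span ℂ (Set.range fun p : Interior bmX bmY × Interior bmX bmY =>
          linnZ bmX bmY p.1 p.2)).comap ((bmX.linnL.flip x').comp (bmX.rsL x)) := by
      refine Submodule.span_le.2 ?_
      rintro _ ⟨⟨y, y'⟩, rfl⟩
      exact Submodule.subset_span ⟨(Interior.mk bmX bmY x y, Interior.mk bmX bmY x' y'), rfl⟩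
    have h₁ := h (hY.2.1 ▸ Submodule.mem_top : (1 : B) ∈ _)
    rw [Submodule.mem_comap, LinearMap.comp_apply, Bimod.rsL_apply, bmX.rs_one] at h₁
    exact h₁
  · rw [eq_top_iff, ← hY.2.2, Submodule.span_le]
    rintro _ ⟨⟨y, y'⟩, rfl⟩
    have h : Submodule.span ℂ (Set.range fun p : X × X => bmX.rinn p.1 p.2) ≤
        (Submodule.span ℂ (Set.range fun p : Interior bmX bmY × Interior bmX bmY =>
          rinnZ bmX bmY p.1 p.2)).comap ((bmY.rinnL y).comp (bmY.lsL.flip y')) := by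
      refine Submodule.span_le.2 ?_
      rintro _ ⟨⟨x, x'⟩, rfl⟩
      exact Submodule.subset_span ⟨(Interior.mk bmX bmY x y, Interior.mk bmX bmY x' y'), rfl⟩
    have h₁ := h (hX.2.2 ▸ Submodule.mem_top : (1 : B) ∈ _)
    rw [Submodule.mem_comap, LinearMap.comp_apply, LinearMap.flip_apply, Bimod.lsL_apply,
      bmY.ls_one] at h₁
    exact h₁

end InteriorBimod

/-! ### Transitivity -/

section TensorForms
variable {C : Type*} [Ring C] [Algebra ℂ C]
variable {P Q R S U : Type*} [AddCommGroup P] [Module ℂ P] [AddCommGroup Q] [Module ℂ Q]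
  [AddCommGroup R] [Module ℂ R] [AddCommGroup S] [Module ℂ S] [AddCommGroup U] [Module ℂ U]

theorem map_tensorAct {R' P' Q' : Type*} [AddCommGroup R'] [Module ℂ R'] [AddCommGroup P']
    [Module ℂ P'] [AddCommGroup Q'] [Module ℂ Q'] {f : P →ₗ[ℂ] Q →ₗ[ℂ] R}
    {g : P' →ₗ[ℂ] Q' →ₗ[ℂ] R'} {j : R →ₗ[ℂ] R'} {k : P →ₗ[ℂ] P'} {l : Q →ₗ[ℂ] Q'}
    (h : ∀ p q, j (f p q) = g (k p) (l q)) (s : P ⊗[ℂ] C) (t : Q ⊗[ℂ] C) :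
    TensorProduct.map j LinearMap.id (tensorAct C f s t)
      = tensorAct C g (TensorProduct.map k LinearMap.id s) (TensorProduct.map l LinearMap.id t) := by
  induction s using TensorProduct.induction_on with
  | zero => simp
  | add x y hx hy => simp only [map_add, LinearMap.add_apply, hx, hy]
  | tmul p c =>
  induction t using TensorProduct.induction_on with
  | zero => simp
  | add x y hx hy => simp only [map_add, hx, hy]
  | tmul q d => simp [h]

theorem appRight_tensorAct_sum {ε : C →ₗ[ℂ] ℂ} {n : ℕ} {φ ψ : Fin n → C →ₗ[ℂ] ℂ}
    (hε : ∀ c d, ε (c * d) = ∑ i, φ i c * ψ i d) (f : P →ₗ[ℂ] Q →ₗ[ℂ] R)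
    (s : P ⊗[ℂ] C) (t : Q ⊗[ℂ] C) :
    appRight ε (tensorAct C f s t) = ∑ i, f (appRight (φ i) s) (appRight (ψ i) t) := by
  induction s using TensorProduct.induction_on with
  | zero => simp
  | add x y hx hy => simp only [map_add, LinearMap.add_apply, hx, hy, Finset.sum_add_distrib]
  | tmul p c =>
  induction t using TensorProduct.induction_on with
  | zero => simp
  | add x y hx hy => simp only [map_add, hx, hy, Finset.sum_add_distrib]
  | tmul q d =>
    simp only [tensorAct_tmul, appRight_tmul, hε, Finset.sum_smul, map_smul, LinearMap.smul_apply]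
    exact Finset.sum_congr rfl fun i _ => by rw [smul_smul, mul_comm]

variable [StarRing C] [StarModule ℂ C]

theorem tensorInnL_tensorAct {f : P →ₗ[ℂ] P →ₛₗ[starRingEnd ℂ] R} {g : P →ₗ[ℂ] S →ₗ[ℂ] P}
    {k : Q →ₗ[ℂ] Q →ₛₗ[starRingEnd ℂ] S} {l : U →ₗ[ℂ] U →ₛₗ[starRingEnd ℂ] R}
    {m : P →ₗ[ℂ] Q →ₗ[ℂ] U} (h : ∀ p q p' q', l (m p q) (m p' q') = f (g p (k q q')) p')
    (s s' : P ⊗[ℂ] C) (t t' : Q ⊗[ℂ] C) :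
    tensorInnL C l (tensorAct C m s t) (tensorAct C m s' t')
      = tensorInnL C f (tensorAct C g s (tensorInnL C k t t')) s' := by
  induction s using TensorProduct.induction_on with
  | zero => simp
  | add x y hx hy => simp only [map_add, LinearMap.add_apply, hx, hy]
  | tmul p c =>
  induction t using TensorProduct.induction_on with
  | zero => simp
  | add x y hx hy => simp only [map_add, LinearMap.add_apply, hx, hy]
  | tmul q d =>
  induction s' using TensorProduct.induction_on with
  | zero => simp
  | add x y hx hy => simp only [map_add, LinearMap.add_apply, hx, hy]
  | tmul p' c' =>
  induction t' using TensorProduct.induction_on with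
  | zero => simp
  | add x y hx hy => simp only [map_add, LinearMap.add_apply, hx, hy]
  | tmul q' d' => simp [h, mul_assoc]

theorem tensorInnR_tensorAct {f : P →ₛₗ[starRingEnd ℂ] P →ₗ[ℂ] S} {g : S →ₗ[ℂ] Q →ₗ[ℂ] Q}
    {k : Q →ₛₗ[starRingEnd ℂ] Q →ₗ[ℂ] R} {l : U →ₛₗ[starRingEnd ℂ] U →ₗ[ℂ] R}
    {m : P →ₗ[ℂ] Q →ₗ[ℂ] U} (h : ∀ p q p' q', l (m p q) (m p' q') = k q (g (f p p') q'))
    (s s' : P ⊗[ℂ] C) (t t' : Q ⊗[ℂ] C) :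
    tensorInnR C l (tensorAct C m s t) (tensorAct C m s' t')
      = tensorInnR C k t (tensorAct C g (tensorInnR C f s s') t') := by
  induction s using TensorProduct.induction_on with
  | zero => simp
  | add x y hx hy => simp only [map_add, LinearMap.add_apply, hx, hy]
  | tmul p c =>
  induction t using TensorProduct.induction_on with
  | zero => simp
  | add x y hx hy => simp only [map_add, LinearMap.add_apply, hx, hy]
  | tmul q d =>
  induction s' using TensorProduct.induction_on with
  | zero => simp
  | add x y hx hy => simp only [map_add, LinearMap.add_apply, hx, hy]
  | tmul p' c' =>
  induction t' using TensorProduct.induction_on with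
  | zero => simp
  | add x y hx hy => simp only [map_add, hx, hy]
  | tmul q' d' => simp [h, mul_assoc]

end TensorForms

section InteriorCoact
variable {H0 : Type u} [Ring H0] [Algebra ℂ H0] [StarRing H0] [StarModule ℂ H0]
  [FiniteDimensional ℂ H0]
variable {A B C X Y : Type u} [CStarAlgebra A] [CStarAlgebra B] [CStarAlgebra C]
  [AddCommGroup X] [Module ℂ X] [AddCommGroup Y] [Module ℂ Y]
  {bmX : Bimod A B X} {bmY : Bimod B C Y}
  {ρ : A →ₗ[ℂ] A ⊗[ℂ] H0} {σ : B →ₗ[ℂ] B ⊗[ℂ] H0} {γ : C →ₗ[ℂ] C ⊗[ℂ] H0}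
  {lam : X →ₗ[ℂ] X ⊗[ℂ] H0} {mu : Y →ₗ[ℂ] Y ⊗[ℂ] H0} {ε0 : H0 →ₗ[ℂ] ℂ}

/-- The map `λ ⊗ μ` on the interior tensor product. -/
def interiorCoact (hX : IsWeakCoactionBimod ε0 bmX ρ σ lam)
    (hY : IsWeakCoactionBimod ε0 bmY σ γ mu) :
    Interior bmX bmY →ₗ[ℂ] Interior bmX bmY ⊗[ℂ] H0 :=
  Interior.lift ((tensorAct H0 (Interior.mk bmX bmY)).compl₁₂ lam mu) fun x b y => by
    rw [LinearMap.compl₁₂_apply, LinearMap.compl₁₂_apply,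
      (isWeakCoactionBimod_iff.1 hX).2.1, (isWeakCoactionBimod_iff.1 hY).1]
    exact tensorAct_assoc (Interior.mk_balanced bmX bmY) _ _ _

theorem interiorCoact_mk (hX : IsWeakCoactionBimod ε0 bmX ρ σ lam)
    (hY : IsWeakCoactionBimod ε0 bmY σ γ mu) (x : X) (y : Y) :
    interiorCoact hX hY (Interior.mk bmX bmY x y)
      = tensorAct H0 (Interior.mk bmX bmY) (lam x) (mu y) := rfl

theorem IsWeakCoactionBimod.interior (hX : IsWeakCoactionBimod ε0 bmX ρ σ lam)
    (hY : IsWeakCoactionBimod ε0 bmY σ γ mu) (hε : ∀ c d, ε0 (c * d) = ε0 c * ε0 d)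
    (hfX : bmX.FiniteType) (hfY : bmY.FiniteType) :
    IsWeakCoactionBimod ε0 (bmX.interior bmY hfX hfY) ρ γ (interiorCoact hX hY) := by
  obtain ⟨hX₁, hX₂, hX₃, hX₄, hX₅⟩ := isWeakCoactionBimod_iff.1 hX
  obtain ⟨hY₁, hY₂, hY₃, hY₄, hY₅⟩ := isWeakCoactionBimod_iff.1 hY
  simp only [isWeakCoactionBimod_iff, ← Bimod.lsL_apply, ← Bimod.rsL_apply, ← Bimod.linnL_apply,
    ← Bimod.rinnL_apply]
  refine ⟨fun a z => ?_, fun z c => ?_, fun z z' => ?_, fun z z' => ?_, fun z => ?_⟩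
  · induction z using Interior.induction with
    | h0 => simp only [map_zero]
    | hadd z₁ z₂ h₁ h₂ => simp only [map_add, h₁, h₂]
    | hmk x y =>
      change tensorAct H0 (Interior.mk bmX bmY) (lam (bmX.ls a x)) (mu y) = _
      rw [hX₁]
      exact tensorAct_assoc (fun _ _ _ => rfl) _ _ _
  · induction z using Interior.induction with
    | h0 => simp only [map_zero, LinearMap.zero_apply]
    | hadd z₁ z₂ h₁ h₂ => simp only [map_add, LinearMap.add_apply, h₁, h₂]
    | hmk x y =>
      change tensorAct H0 (Interior.mk bmX bmY) (lam x) (mu (bmY.rs y c)) = _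
      rw [hY₂]
      exact (tensorAct_assoc (fun _ _ _ => rfl) _ _ _).symm
  · induction z using Interior.induction with
    | h0 => simp only [map_zero, LinearMap.zero_apply]
    | hadd z₁ z₂ h₁ h₂ => simp only [map_add, LinearMap.add_apply, h₁, h₂]
    | hmk x y =>
    induction z' using Interior.induction with
    | h0 => simp only [map_zero]
    | hadd z₁ z₂ h₁ h₂ => simp only [map_add, h₁, h₂]
    | hmk x' y' =>
      change ρ (bmX.linn (bmX.rs x (bmY.linn y y')) x') = _
      rw [hX₃, hX₂, hY₃]
      exact (tensorInnL_tensorAct (fun _ _ _ _ => rfl) _ _ _ _).symm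
  · induction z using Interior.induction with
    | h0 => simp only [map_zero, LinearMap.zero_apply]
    | hadd z₁ z₂ h₁ h₂ => simp only [map_add, LinearMap.add_apply, h₁, h₂]
    | hmk x y =>
    induction z' using Interior.induction with
    | h0 => simp only [map_zero]
    | hadd z₁ z₂ h₁ h₂ => simp only [map_add, h₁, h₂]
    | hmk x' y' =>
      change γ (bmY.rinn y (bmY.ls (bmX.rinn x x') y')) = _
      rw [hY₄, hY₁, hX₄]
      exact (tensorInnR_tensorAct (fun _ _ _ _ => rfl) _ _ _ _).symm
  · induction z using Interior.induction with
    | h0 => simp only [map_zero]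
    | hadd z₁ z₂ h₁ h₂ => simp only [map_add, h₁, h₂]
    | hmk x y => rw [interiorCoact_mk, appRight_tensorAct ε0 hε, hX₅, hY₅]

theorem IsTwistedCoactionBimod.interior
    {Δ0 : H0 →ₐ[ℂ] H0 ⊗[ℂ] H0} {u : (A ⊗[ℂ] H0) ⊗[ℂ] H0} {v : (B ⊗[ℂ] H0) ⊗[ℂ] H0}
    {w : (C ⊗[ℂ] H0) ⊗[ℂ] H0}
    (hX : IsTwistedCoactionBimod Δ0.toLinearMap ε0 bmX ρ u σ v lam)
    (hY : IsTwistedCoactionBimod Δ0.toLinearMap ε0 bmY σ v γ w mu)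
    (hε : ∀ c d, ε0 (c * d) = ε0 c * ε0 d)
    (hv : tstarWith (tstarWith star) v * v = 1)
    (hfX : bmX.FiniteType) (hfY : bmY.FiniteType) :
    IsTwistedCoactionBimod Δ0.toLinearMap ε0 (bmX.interior bmY hfX hfY) ρ u γ w
      (interiorCoact hX.toIsWeakCoactionBimod hY.toIsWeakCoactionBimod) := by
  refine isTwistedCoactionBimod_iff.2 ⟨hX.toIsWeakCoactionBimod.interior
    hY.toIsWeakCoactionBimod hε hfX hfY, fun z => ?_⟩
  rw [tstarWith_tstarWith_star] at hv
  have hcancel : ∀ t : (Y ⊗[ℂ] H0) ⊗[ℂ] H0, tensorAct H0 (tensorAct H0 bmY.lsL)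
      (tensorStar H0 (tensorStar H0 (starL B)) v)
      (tensorAct H0 (tensorAct H0 bmY.lsL) v t) = t := fun t => by
    rw [← tensorAct_assoc (f₁ := tensorAct H0 bmY.lsL) (f₂ := tensorAct H0 (LinearMap.mul ℂ B))
      fun p q s => tensorAct_assoc (fun p q s => bmY.ls_mul p q s) p q s,
      tensorAct_mul_eq, tensorAct_mul, hv]
    exact tensorAct_one_left (tensorAct_one_left bmY.ls_one) t
  induction z using Interior.induction with
  | h0 => simp only [map_zero, LinearMap.zero_apply]
  | hadd z₁ z₂ h₁ h₂ => simp only [map_add, LinearMap.add_apply, h₁, h₂]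
  | hmk x y =>
  rw [interiorCoact_mk, map_tensorAct (interiorCoact_mk _ _), hX.twisted', hY.twisted',
    expand_tensorAct,
    ← tensorAct_assoc (f₁ := tensorAct H0 (bmX.interior bmY hfX hfY).rsL)
      (f₂ := tensorAct H0 (Interior.mk bmX bmY)) fun p q s =>
        tensorAct_assoc (fun _ _ _ => rfl) p q s,
    tensorAct_assoc (f₃ := tensorAct H0 (Interior.mk bmX bmY)) (f₄ := tensorAct H0 bmY.lsL)
      fun p q s => tensorAct_assoc (Interior.mk_balanced bmX bmY) p q s,
    hcancel,
    tensorAct_assoc (f₃ := tensorAct H0 (bmX.interior bmY hfX hfY).lsL)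
      (f₄ := tensorAct H0 (Interior.mk bmX bmY)) fun p q s =>
        tensorAct_assoc (fun _ _ _ => rfl) p q s]

end InteriorCoact

/-- Strong Morita equivalence of twisted coactions of `H0` on unital
C*-algebras is an equivalence relation; in particular, in the transitivity situation, if
`(ρ,u) ∼ (σ,v)` via `(X, λ)` and `(σ,v) ∼ (γ,w)` via `(Y, μ)`, then there is a twisted
coaction `ν` of `H0` on the interior tensor product `Z = X ⊗_B Y` (presented by a balanced
surjective bilinear map `θ : X × Y → Z` with the canonical induced equivalence-bimodule
structure) satisfying `h ·_ν θ(x,y) = Σ θ(h₍₁₎ ·_λ x, h₍₂₎ ·_μ y)`, and `ν` implements a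
strong Morita equivalence between `(ρ,u)` and `(γ,w)`. -/
theorem twistedSME_equivalence_relation
    {H H0 : Type u} [CStarAlgebra H] [StarModule ℂ H] [FiniteDimensional ℂ H]
    [CStarAlgebra H0] [StarModule ℂ H0] [FiniteDimensional ℂ H0]
    (dp : HopfPairData H H0) :
    -- the relation is an equivalence relation
    ((∀ P : TwCoactedCStar.{u} H0,
        IsTwistedCoaction dp.dH0.comul.toLinearMap dp.dH0.counit.toLinearMap
          P.coact P.cocyc →
        TwistedSME dp.dH0.comul.toLinearMap dp.dH0.counit.toLinearMap
          P.coact P.cocyc P.coact P.cocyc) ∧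
     (∀ P Q : TwCoactedCStar.{u} H0,
        IsTwistedCoaction dp.dH0.comul.toLinearMap dp.dH0.counit.toLinearMap
          P.coact P.cocyc →
        IsTwistedCoaction dp.dH0.comul.toLinearMap dp.dH0.counit.toLinearMap
          Q.coact Q.cocyc →
        TwistedSME dp.dH0.comul.toLinearMap dp.dH0.counit.toLinearMap
          P.coact P.cocyc Q.coact Q.cocyc →
        TwistedSME dp.dH0.comul.toLinearMap dp.dH0.counit.toLinearMap
          Q.coact Q.cocyc P.coact P.cocyc) ∧
     (∀ P Q R : TwCoactedCStar.{u} H0,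
        IsTwistedCoaction dp.dH0.comul.toLinearMap dp.dH0.counit.toLinearMap
          P.coact P.cocyc →
        IsTwistedCoaction dp.dH0.comul.toLinearMap dp.dH0.counit.toLinearMap
          Q.coact Q.cocyc →
        IsTwistedCoaction dp.dH0.comul.toLinearMap dp.dH0.counit.toLinearMap
          R.coact R.cocyc →
        TwistedSME dp.dH0.comul.toLinearMap dp.dH0.counit.toLinearMap
          P.coact P.cocyc Q.coact Q.cocyc →
        TwistedSME dp.dH0.comul.toLinearMap dp.dH0.counit.toLinearMap
          Q.coact Q.cocyc R.coact R.cocyc →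
        TwistedSME dp.dH0.comul.toLinearMap dp.dH0.counit.toLinearMap
          P.coact P.cocyc R.coact R.cocyc)) ∧
    -- transitivity via the interior tensor product `X ⊗_B Y`
    (∀ (A B C : Type u) (_ : CStarAlgebra A) (_ : StarModule ℂ A)
        (_ : CStarAlgebra B) (_ : StarModule ℂ B) (_ : CStarAlgebra C) (_ : StarModule ℂ C)
        (ρ : A →ₗ[ℂ] A ⊗[ℂ] H0) (u : (A ⊗[ℂ] H0) ⊗[ℂ] H0)
        (σ : B →ₗ[ℂ] B ⊗[ℂ] H0) (v : (B ⊗[ℂ] H0) ⊗[ℂ] H0)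
        (γ : C →ₗ[ℂ] C ⊗[ℂ] H0) (w : (C ⊗[ℂ] H0) ⊗[ℂ] H0)
        (_ : IsTwistedCoaction dp.dH0.comul.toLinearMap dp.dH0.counit.toLinearMap ρ u)
        (_ : IsTwistedCoaction dp.dH0.comul.toLinearMap dp.dH0.counit.toLinearMap σ v)
        (_ : IsTwistedCoaction dp.dH0.comul.toLinearMap dp.dH0.counit.toLinearMap γ w)
        (X Y : Type u) (_ : AddCommGroup X) (_ : Module ℂ X)
        (_ : AddCommGroup Y) (_ : Module ℂ Y)
        (bmX : Bimod A B X) (bmY : Bimod B C Y)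
        (_ : bmX.IsEquivalence) (_ : bmY.IsEquivalence)
        (lam : X →ₗ[ℂ] X ⊗[ℂ] H0) (mu : Y →ₗ[ℂ] Y ⊗[ℂ] H0)
        (_ : IsTwistedCoactionBimod dp.dH0.comul.toLinearMap dp.dH0.counit.toLinearMap
          bmX ρ u σ v lam)
        (_ : IsTwistedCoactionBimod dp.dH0.comul.toLinearMap dp.dH0.counit.toLinearMap
          bmY σ v γ w mu),
      ∃ (Z : Type u) (_ : AddCommGroup Z) (_ : Module ℂ Z) (bmZ : Bimod A C Z)
        (θ : X → Y → Z) (ν : Z →ₗ[ℂ] Z ⊗[ℂ] H0),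
        bmZ.IsEquivalence ∧
        (∀ x x' y, θ (x + x') y = θ x y + θ x' y) ∧
        (∀ x y y', θ x (y + y') = θ x y + θ x y') ∧
        (∀ (c : ℂ) x y, θ (c • x) y = c • θ x y) ∧
        (∀ (c : ℂ) x y, θ x (c • y) = c • θ x y) ∧
        (∀ x b y, θ (bmX.rs x b) y = θ x (bmY.ls b y)) ∧
        (∀ a x y, bmZ.ls a (θ x y) = θ (bmX.ls a x) y) ∧
        (∀ x y c, bmZ.rs (θ x y) c = θ x (bmY.rs y c)) ∧
        (∀ x y x' y', bmZ.linn (θ x y) (θ x' y')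
            = bmX.linn (bmX.rs x (bmY.linn y y')) x') ∧
        (∀ x y x' y', bmZ.rinn (θ x y) (θ x' y')
            = bmY.rinn y (bmY.ls (bmX.rinn x x') y')) ∧
        Submodule.span ℂ (Set.range fun p : X × Y => θ p.1 p.2) = ⊤ ∧
        IsTwistedCoactionBimod dp.dH0.comul.toLinearMap dp.dH0.counit.toLinearMap
          bmZ ρ u γ w ν ∧
        (∀ (h : H) (x : X) (y : Y) (n : ℕ) (h1 h2 : Fin n → H),
          dp.dH.comul h = ∑ i, h1 i ⊗ₜ h2 i →
          coactAct dp ν h (θ x y)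
            = ∑ i, θ (coactAct dp lam (h1 i) x) (coactAct dp mu (h2 i) y))) := by
  have hε : ∀ c d, dp.dH0.counit.toLinearMap (c * d)
      = dp.dH0.counit.toLinearMap c * dp.dH0.counit.toLinearMap d := map_mul dp.dH0.counit
  have hΔs : ∀ h, dp.dH0.comul.toLinearMap (star h)
      = tensorStar H0 (starL H0) (dp.dH0.comul.toLinearMap h) := fun h => by
    change dp.dH0.comul (star h) = _
    rw [dp.dH0.comul_star, tstarWith_star]
    rfl
  refine ⟨⟨fun P hP => ?_, ?_, ?_⟩, ?_⟩
  · have hA : ∀ a : P.carrier, star a * a = 0 → a = 0 :=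
      fun a ha => (CStarRing.star_mul_self_eq_zero_iff a).1 ha
    exact ⟨P.carrier, _, _, Bimod.self hA, Bimod.self_isEquivalence hA, P.coact, hP.self hA⟩
  · rintro P Q hP hQ ⟨X, _, _, bm, hbm, lam, hlam⟩
    have hdef := bm.linn_definite hbm
    exact ⟨Conj X, _, _, bm.conj hdef, Bimod.conj_isEquivalence hbm hdef, conjCoact lam,
      hlam.conj hP.toIsWeakCoaction hQ.toIsWeakCoaction hΔs dp.dH0.counit_star hdef⟩
  · rintro P Q R - hQ - ⟨X, _, _, bmX, hbmX, lam, hlam⟩ ⟨Y, _, _, bmY, hbmY, mu, hmu⟩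
    exact ⟨Interior bmX bmY, _, _, bmX.interior bmY hbmX.finiteType hbmY.finiteType,
      Bimod.interior_isEquivalence hbmX hbmY, _,
      hlam.interior hmu hε hQ.unitary_right hbmX.finiteType hbmY.finiteType⟩
  · intro A B C _ _ _ _ _ _ ρ u σ v γ w _ hσ _ X Y _ _ _ _ bmX bmY hbmX hbmY lam mu hlam hmu
    refine ⟨Interior bmX bmY, _, _, bmX.interior bmY hbmX.finiteType hbmY.finiteType,
      fun x y => Interior.mk bmX bmY x y, _, Bimod.interior_isEquivalence hbmX hbmY,
      fun x x' y => LinearMap.map_add₂ _ x x' y, fun x y y' => map_add _ y y',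
      fun c x y => LinearMap.map_smul₂ _ c x y, fun c x y => map_smul _ c y,
      Interior.mk_balanced bmX bmY, fun _ _ _ => rfl, fun _ _ _ => rfl, fun _ _ _ _ => rfl,
      fun _ _ _ _ => rfl, Interior.span_mk,
      hlam.interior hmu hε hσ.unitary_right hbmX.finiteType hbmY.finiteType,
      fun h x y n h1 h2 hh => ?_⟩
    exact appRight_tensorAct_sum
      (fun c d => dp.pair_mul_right h c d n h1 h2 hh) (Interior.mk bmX bmY) (lam x) (mu y)

end SMEPaper
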